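/- Let I be a Z^v-graded ideal of S and let L be a Z^v-graded (i.e. multihomogeneous of degree some e_i) linear form of S. (a) If I is a Cartwright-Sturmfels* ideal of S, then the colon ideal I : L is a Cartwright-Sturmfels* ideal of S, and the image of I + (L) in S/(L) is a Cartwright-Sturmfels* ideal of S/(L), and I ∩ (L) is a Cartwright-Sturmfels* ideal of S. (b) If I is a Cartwright-Sturmfels ideal of S, then I : L is a Cartwright-Sturmfels ideal of S. -/

import Mathlib

open MvPolynomial

noncomputable section

namespace CSPaper

/-- The set of variables of the standard `ℤ^v`-graded polynomial ring `S`: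
the variable `x_{i j}` of the paper (with `1 ≤ i ≤ v`, `1 ≤ j ≤ n_i`) corresponds to
`⟨i-1, j-1⟩ : MVar v n` where `n (i-1) = n_i - 1`; thus row `i` has `n i + 1 > 0`
variables and the first variable `x_{i 1}` of row `i` corresponds to `⟨i, 0⟩`. -/
abbrev MVar (v : ℕ) (n : Fin v → ℕ) : Type := Σ i : Fin v, Fin (n i + 1)

/-- The weight function giving the standard `ℤ^v`-grading: `deg (x_{i j}) = e_i ∈ ℤ^v`. -/
def wt (v : ℕ) (n : Fin v → ℕ) : MVar v n → (Fin v → ℕ) := fun p => Pi.single p.1 1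

variable {K : Type} [Field K] {v : ℕ} {n : Fin v → ℕ}

/-- An ideal of `S` is `ℤ^v`-graded (multigraded) iff it contains every multihomogeneous
component of each of its elements. -/
def IsMultigraded (I : Ideal (MvPolynomial (MVar v n) K)) : Prop :=
  ∀ f ∈ I, ∀ a : Fin v → ℕ, weightedHomogeneousComponent (wt v n) a f ∈ I

/-- The value of the `ℤ^v`-graded Hilbert function of the ideal `I` at `a ∈ ℕ^v`:
`dim_K I_a`. -/
def hilb (I : Ideal (MvPolynomial (MVar v n) K)) (a : Fin v → ℕ) : ℕ :=
  Module.finrank K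
    ((Submodule.restrictScalars K I ⊓ weightedHomogeneousSubmodule K (wt v n) a :
      Submodule K (MvPolynomial (MVar v n) K)))

/-- Two ideals have the same `ℤ^v`-graded Hilbert series. -/
def sameHS (I J : Ideal (MvPolynomial (MVar v n) K)) : Prop :=
  ∀ a : Fin v → ℕ, hilb I a = hilb J a

/-- The `ℤ^v`-graded `K`-algebra endomorphism of `S` determined by a `v`-tuple of square
matrices: `x_{i j} ↦ ∑_k (g i)_{k j} x_{i k}`.  For invertible `g i` these are exactly the
elements of `G = GL_{n_1}(K) × ⋯ × GL_{n_v}(K)` acting on `S`. -/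
def gAct (g : ∀ i : Fin v, Matrix (Fin (n i + 1)) (Fin (n i + 1)) K) :
    MvPolynomial (MVar v n) K →ₐ[K] MvPolynomial (MVar v n) K :=
  aeval fun p : MVar v n => ∑ k : Fin (n p.1 + 1), C (g p.1 k p.2) * X ⟨p.1, k⟩

/-- A property `P` of `v`-tuples of matrices holds generically (i.e. for a general
`g ∈ GL_{n_1}(K) × ⋯ × GL_{n_v}(K)`) if there is a nonzero polynomial `h` in the matrix
entries such that `P g` holds for every invertible `g` with `h(g) ≠ 0`. -/
def Generically
    (P : (∀ i : Fin v, Matrix (Fin (n i + 1)) (Fin (n i + 1)) K) → Prop) : Prop :=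
  ∃ h : MvPolynomial (Σ i : Fin v, Fin (n i + 1) × Fin (n i + 1)) K, h ≠ 0 ∧
    ∀ g : ∀ i : Fin v, Matrix (Fin (n i + 1)) (Fin (n i + 1)) K,
      (∀ i, IsUnit (g i).det) →
      eval (fun q : Σ i : Fin v, Fin (n i + 1) × Fin (n i + 1) => g q.1 q.2.1 q.2.2) h ≠ 0 →
      P g

/-- The leading exponent (exponent of the leading monomial) of a polynomial with respect to
a term order `τ` (a `MonomialOrder`); by convention `leadExp τ 0 = 0`. -/
def leadExp (τ : MonomialOrder (MVar v n)) (f : MvPolynomial (MVar v n) K) :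
    MVar v n →₀ ℕ :=
  τ.toSyn.symm (f.support.sup τ.toSyn)

/-- The initial ideal `in_τ(I)`: the monomial ideal generated by the leading monomials of the
nonzero elements of `I`. -/
def inIdeal (τ : MonomialOrder (MVar v n)) (I : Ideal (MvPolynomial (MVar v n) K)) :
    Ideal (MvPolynomial (MVar v n) K) :=
  Ideal.span {m | ∃ f ∈ I, f ≠ 0 ∧ m = monomial (leadExp τ f) (1 : K)}

/-- `G` is a Gröbner basis of `I` with respect to the term order `τ`. -/
def IsGroebnerBasis (τ : MonomialOrder (MVar v n)) (G : Set (MvPolynomial (MVar v n) K))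
    (I : Ideal (MvPolynomial (MVar v n) K)) : Prop :=
  G ⊆ (I : Set (MvPolynomial (MVar v n) K)) ∧
    Ideal.span ((fun f => monomial (leadExp τ f) (1 : K)) '' {f ∈ G | f ≠ 0}) = inIdeal τ I

/-- `J = gin_τ(I)`, the `ℤ^v`-graded generic initial ideal: for a general
`g ∈ GL_{n_1}(K) × ⋯ × GL_{n_v}(K)` one has `in_τ(g(I)) = J`. -/
def IsGin (τ : MonomialOrder (MVar v n)) (I J : Ideal (MvPolynomial (MVar v n) K)) : Prop :=
  Generically fun g => inIdeal τ (Ideal.map (gAct g) I) = J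

/-- A term order such that `x_{i j} > x_{i k}` whenever `j < k`. -/
def RespectsVarOrder (τ : MonomialOrder (MVar v n)) : Prop :=
  ∀ (i : Fin v) (j k : Fin (n i + 1)), j < k →
    τ.toSyn (Finsupp.single (⟨i, k⟩ : MVar v n) 1) <
      τ.toSyn (Finsupp.single (⟨i, j⟩ : MVar v n) 1)

/-- An ideal is Borel fixed if it is fixed by every element of the Borel subgroup
`B = B_{n_1}(K) × ⋯ × B_{n_v}(K)` of upper triangular invertible matrices (upper triangular
with respect to the order `x_{i 1} > x_{i 2} > ⋯` of the variables in each row). -/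
def BorelFixed (I : Ideal (MvPolynomial (MVar v n) K)) : Prop :=
  ∀ g : ∀ i : Fin v, Matrix (Fin (n i + 1)) (Fin (n i + 1)) K,
    (∀ i, IsUnit (g i).det) →
    (∀ (i : Fin v) (k j : Fin (n i + 1)), j < k → g i k j = 0) →
    Ideal.map (gAct g) I = I

/-- A Cartwright-Sturmfels ideal: a `ℤ^v`-graded ideal with the same `ℤ^v`-graded Hilbert
series as some radical Borel fixed ideal. -/
def IsCS (I : Ideal (MvPolynomial (MVar v n) K)) : Prop :=
  IsMultigraded I ∧ ∃ J : Ideal (MvPolynomial (MVar v n) K),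
    J.IsRadical ∧ BorelFixed J ∧ sameHS I J

/-- The exponent of the monomial `x_{1 1}^{a 1} ⋯ x_{v 1}^{a v}` of
`T = K[x_{1 1}, …, x_{v 1}] ⊆ S`. -/
def Tmono (v : ℕ) (n : Fin v → ℕ) (a : Fin v → ℕ) : MVar v n →₀ ℕ :=
  ∑ i : Fin v, Finsupp.single (⟨i, 0⟩ : MVar v n) (a i)

/-- A `ℤ^v`-graded ideal of `S` extended from `T`, i.e. generated by monomials in the
variables `x_{1 1}, …, x_{v 1}`. -/
def ExtendedFromT (J : Ideal (MvPolynomial (MVar v n) K)) : Prop :=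
  ∃ A : Set (Fin v → ℕ),
    J = Ideal.span ((fun a => monomial (Tmono v n a) (1 : K)) '' A)

/-- A Cartwright-Sturmfels* ideal: a `ℤ^v`-graded ideal with the same `ℤ^v`-graded Hilbert
series as some ideal extended from `T`. -/
def IsCSstar (J : Ideal (MvPolynomial (MVar v n) K)) : Prop :=
  IsMultigraded J ∧ ∃ C : Ideal (MvPolynomial (MVar v n) K), ExtendedFromT C ∧ sameHS J C

/-- A monomial ideal. -/
def IsMonomialIdeal (I : Ideal (MvPolynomial (MVar v n) K)) : Prop :=
  ∃ A : Set (MVar v n →₀ ℕ), I = Ideal.span ((fun s => monomial s (1 : K)) '' A)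

/-- A squarefree monomial ideal. -/
def IsSqfreeMonomialIdeal (I : Ideal (MvPolynomial (MVar v n) K)) : Prop :=
  ∃ A : Set (MVar v n →₀ ℕ), (∀ s ∈ A, ∀ x, s x ≤ 1) ∧
    I = Ideal.span ((fun s => monomial s (1 : K)) '' A)

/-- `J` is the Alexander dual of the squarefree monomial ideal `I`: `J` is generated by the
products `∏_{x ∈ P} x` as `P` ranges over the minimal primes of `I`. -/
def IsAlexanderDual (I J : Ideal (MvPolynomial (MVar v n) K)) : Prop :=
  J = Ideal.span {m | ∃ F : Finset (MVar v n),
    Ideal.span ((fun x => (X x : MvPolynomial (MVar v n) K)) '' ↑F) ∈ I.minimalPrimes ∧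
    m = ∏ x ∈ F, X x}

/-- The sequence `x_{i j} - λ_{i j} x_{i 1}`, `1 ≤ i ≤ v`, `2 ≤ j ≤ n_i`, as a list. -/
def LamList (lam : MVar v n → K) : List (MvPolynomial (MVar v n) K) :=
  (List.finRange v).flatMap fun i =>
    ((List.finRange (n i + 1)).drop 1).map fun j =>
      X (⟨i, j⟩ : MVar v n) - C (lam ⟨i, j⟩) * X (⟨i, 0⟩ : MVar v n)

/-- A property of the scalars `λ = (λ_{i j})` holds for general `λ ∈ K^N` if there is a
nonzero polynomial `h` in the `λ_{i j}` such that the property holds whenever `h(λ) ≠ 0`. -/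
def GenericallyLam {v : ℕ} {n : Fin v → ℕ} (K : Type) [Field K]
    (P : (MVar v n → K) → Prop) : Prop :=
  ∃ h : MvPolynomial (MVar v n) K, h ≠ 0 ∧
    ∀ lam : MVar v n → K, eval lam h ≠ 0 → P lam

variable {K : Type} [Field K] {v : ℕ} {n : Fin v → ℕ}

/-- A graded free resolution of an ideal `I` of a polynomial ring graded by an additive
monoid `M` via a weight function `w` on the variables:
`⋯ → F_2 → F_1 → F_0 → I → 0`, where `F_p` is the free module with (finite) basis `ι p`,
the basis element `i : ι p` having degree `deg p i ∈ M`, all maps are graded of degree `0`,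
and the complex is exact. -/
structure GradedFreeResolution (σ : Type) (K : Type) [Field K] (M : Type) [AddCommMonoid M]
    (w : σ → M) (I : Ideal (MvPolynomial σ K)) where
  ι : ℕ → Type
  finite : ∀ p, Finite (ι p)
  deg : ∀ p, ι p → M
  aug : (ι 0 →₀ MvPolynomial σ K) →ₗ[MvPolynomial σ K] MvPolynomial σ K
  d : ∀ p, (ι (p + 1) →₀ MvPolynomial σ K) →ₗ[MvPolynomial σ K] (ι p →₀ MvPolynomial σ K)
  aug_graded : ∀ i : ι 0, (aug (Finsupp.single i 1)).IsWeightedHomogeneous w (deg 0 i)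
  d_graded : ∀ (p : ℕ) (i : ι (p + 1)) (j : ι p),
    (d p (Finsupp.single i 1)) j = 0 ∨
      ∃ b, ((d p (Finsupp.single i 1)) j).IsWeightedHomogeneous w b ∧
        b + deg p j = deg (p + 1) i
  range_aug : LinearMap.range aug = (I : Submodule (MvPolynomial σ K) (MvPolynomial σ K))
  exact_zero : LinearMap.ker aug = LinearMap.range (d 0)
  exact : ∀ p, LinearMap.ker (d p) = LinearMap.range (d (p + 1))

/-- A graded free resolution is minimal if all entries of the matrices of the differentials
between free modules lie in the irrelevant maximal ideal, i.e. have zero constant term. -/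
def GradedFreeResolution.Minimal {σ M : Type} [AddCommMonoid M] {w : σ → M}
    {I : Ideal (MvPolynomial σ K)} (F : GradedFreeResolution σ K M w I) : Prop :=
  ∀ (p : ℕ) (i : F.ι (p + 1)) (j : F.ι p),
    MvPolynomial.constantCoeff ((F.d p (Finsupp.single i 1)) j) = 0

/-- The graded Betti number `β_{p,a}` read off from a (minimal) graded free resolution:
the number of basis elements of `F_p` of degree `a`. -/
def GradedFreeResolution.betti {σ M : Type} [AddCommMonoid M] {w : σ → M}
    {I : Ideal (MvPolynomial σ K)} (F : GradedFreeResolution σ K M w I) (p : ℕ) (a : M) :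
    ℕ :=
  Nat.card {i : F.ι p // F.deg p i = a}

/-- The set of `t × t` minors of the matrix `A`. -/
def minorsSet {R : Type} [CommRing R] (t : ℕ) {m N : ℕ} (A : Matrix (Fin m) (Fin N) R) :
    Set R :=
  {d | ∃ (r : Fin t → Fin m) (c : Fin t → Fin N),
    Function.Injective r ∧ Function.Injective c ∧ d = (A.submatrix r c).det}

/-- `I_t(A)`, the ideal generated by the `t × t` minors of `A`. -/
def minorsIdeal {R : Type} [CommRing R] (t : ℕ) {m N : ℕ}
    (A : Matrix (Fin m) (Fin N) R) : Ideal R :=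
  Ideal.span (minorsSet t A)

/-- `A` is column-graded: `N ≤ v` and each entry of the `j`-th column is either `0` or
multihomogeneous of degree `e_j ∈ ℤ^v`. -/
def ColumnGraded {m N : ℕ} (A : Matrix (Fin m) (Fin N) (MvPolynomial (MVar v n) K)) :
    Prop :=
  ∃ h : N ≤ v, ∀ i j, A i j = 0 ∨
    (A i j).IsWeightedHomogeneous (wt v n) (Pi.single (Fin.castLE h j) 1)

/-- `A` is row-graded: `m ≤ v` and each entry of the `i`-th row is either `0` or
multihomogeneous of degree `e_i ∈ ℤ^v`. -/
def RowGraded {m N : ℕ} (A : Matrix (Fin m) (Fin N) (MvPolynomial (MVar v n) K)) : Prop :=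
  ∃ h : m ≤ v, ∀ i j, A i j = 0 ∨
    (A i j).IsWeightedHomogeneous (wt v n) (Pi.single (Fin.castLE h i) 1)

/-- The exponent of the polarization of the monomial `x_{1 1}^{a 1} ⋯ x_{v 1}^{a v}` of `T`:
the squarefree monomial `∏_i x_{i 1} x_{i 2} ⋯ x_{i (a i)}`. -/
def polExp (v : ℕ) (n : Fin v → ℕ) (a : Fin v → ℕ) : MVar v n →₀ ℕ :=
  ∑ i : Fin v, ∑ j ∈ Finset.univ.filter (fun j : Fin (n i + 1) => (j : ℕ) < a i),
    Finsupp.single (⟨i, j⟩ : MVar v n) 1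

/-- `P = pol(C)`, the polarization of an ideal `C` extended from `T`
(the exponents of the generators of `C` must fit inside `S`). -/
def IsPolarizationOfT (C P : Ideal (MvPolynomial (MVar v n) K)) : Prop :=
  ∃ A : Set (Fin v → ℕ), (∀ a ∈ A, ∀ i, a i ≤ n i + 1) ∧
    C = Ideal.span ((fun a => monomial (Tmono v n a) (1 : K)) '' A) ∧
    P = Ideal.span ((fun a => monomial (polExp v n a) (1 : K)) '' A)

/-- `ψ` is an identification of the quotient of `S` by the `ℤ^v`-graded ideal `Q` with a
standard `ℤ^v`-graded polynomial ring, compatible with the gradings. -/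
def IsGradedStructureIso {n₂ : Fin v → ℕ} (Q : Ideal (MvPolynomial (MVar v n) K))
    (ψ : (MvPolynomial (MVar v n) K ⧸ Q) ≃ₐ[K] MvPolynomial (MVar v n₂) K) : Prop :=
  ∀ (f : MvPolynomial (MVar v n) K) (a : Fin v → ℕ),
    f.IsWeightedHomogeneous (wt v n) a →
      (ψ (Ideal.Quotient.mk Q f)).IsWeightedHomogeneous (wt v n₂) a

end CSPaper

open CSPaper

namespace CSPaper

set_option linter.unusedSectionVars false

/-- The leading exponents, with respect to `key`, of the polynomials in `V`. -/
def leadSet {σ α K : Type} [Field K] [LinearOrder α] (key : (σ →₀ ℕ) → α)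
    (V : Submodule K (MvPolynomial σ K)) : Set (σ →₀ ℕ) :=
  {u | ∃ f ∈ V, u ∈ f.support ∧ ∀ w ∈ f.support, key w ≤ key u}

theorem finrank_eq_ncard_leadSet {σ α K : Type} [Field K] [LinearOrder α]
    {key : (σ →₀ ℕ) → α} (hkey : Function.Injective key)
    (V : Submodule K (MvPolynomial σ K)) {B : Set (σ →₀ ℕ)} (hB : B.Finite)
    (hV : ∀ f ∈ V, (f.support : Set (σ →₀ ℕ)) ⊆ B) :
    Module.finrank K V = (leadSet key V).ncard := by
  classical
  have hT : (leadSet key V).Finite := hB.subset (by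
    rintro u ⟨f, hf, hu, -⟩
    exact hV f hf hu)
  have := hT.fintype
  let φ : V →ₗ[K] (leadSet key V → K) :=
    LinearMap.pi fun t => (MvPolynomial.lcoeff K t.1) ∘ₗ V.subtype
  have hφ : Function.Injective φ := by
    rw [injective_iff_map_eq_zero]
    rintro ⟨f, hf⟩ h0
    by_contra hne
    have hf0 : f.support.Nonempty := by
      rw [MvPolynomial.support_nonempty]
      rintro rfl
      exact hne rfl
    obtain ⟨u, hu, hmax⟩ := f.support.exists_max_image key hf0
    have := congrFun h0 ⟨u, f, hf, hu, hmax⟩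
    simp [φ] at this
    exact (MvPolynomial.mem_support_iff.1 hu) this
  have : Module.Finite K V := Module.Finite.of_injective φ hφ
  rw [← Nat.card_coe_set_eq, Nat.card_eq_fintype_card]
  apply le_antisymm
  · simpa using LinearMap.finrank_le_finrank_of_injective hφ
  · choose F hFV hFu hFm using fun t : leadSet key V => t.2
    have : LinearIndependent K (fun t => (⟨F t, hFV t⟩ : V)) := by
      rw [Fintype.linearIndependent_iff]
      intro g hg
      by_contra! hne
      obtain ⟨i, hi⟩ := hne
      obtain ⟨t, ht, hmax⟩ := (Finset.univ.filter fun t => g t ≠ 0).exists_max_image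
        (fun t => key t.1) ⟨i, by simpa using hi⟩
      have h1 := congrArg (fun f : V => coeff t.1 f.1) hg
      simp only [AddSubmonoidClass.coe_finsetSum, SetLike.val_smul, coeff_sum, coeff_smul,
        ZeroMemClass.coe_zero, coeff_zero, smul_eq_mul] at h1
      rw [Finset.sum_eq_single t] at h1
      · have h2 := MvPolynomial.mem_support_iff.1 (hFu t)
        simp at ht
        exact (mul_ne_zero ht h2) h1
      · intro b _ hbt
        by_cases hb : g b = 0
        · simp [hb]
        · have hle := hmax b (by simpa using hb)
          have : t.1 ∉ (F b).support := fun hmem =>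
            hbt (Subtype.ext (hkey (le_antisymm hle (hFm b _ hmem))))
          rw [MvPolynomial.notMem_support_iff.1 this, mul_zero]
      · simp
    exact this.fintype_card_le_finrank

/-- An injective key on exponents, compatible with addition, refining an additive weight. -/
theorem exists_key {σ : Type} [Fintype σ] (θ : (σ →₀ ℕ) →+ ℤ) :
    ∃ key : (σ →₀ ℕ) → ℤ ×ₗ Lex (Fin (Fintype.card σ) →₀ ℕ), Function.Injective key ∧
      (∀ u w t, key u ≤ key w → key (u + t) ≤ key (w + t)) ∧
      (∀ u w, θ u < θ w → key u < key w) ∧ (∀ u w, key u ≤ key w → θ u ≤ θ w) := by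
  let r : (σ →₀ ℕ) ≃+ (Fin (Fintype.card σ) →₀ ℕ) := Finsupp.domCongr (Fintype.equivFin σ)
  let key : (σ →₀ ℕ) → ℤ ×ₗ Lex (Fin (Fintype.card σ) →₀ ℕ) :=
    fun u => toLex (θ u, toLex (r u))
  refine ⟨key, ?_, ?_, ?_, ?_⟩
  · intro u w h
    have h2 := (Prod.ext_iff.1 (toLex_inj.1 h)).2
    exact r.injective (toLex_inj.1 h2)
  · intro u w t h
    have e : ∀ u t, key (u + t) = key u + key t := by
      intro u t
      simp only [key, map_add]
      rfl
    rw [e, e]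
    exact add_le_add_left h _
  · intro u w h
    exact Prod.Lex.toLex_lt_toLex.2 (Or.inl h)
  · intro u w h
    rcases Prod.Lex.toLex_le_toLex.1 h with h | h
    · exact h.le
    · exact h.1.le

/-- The weight function of the grading in which the variable `p` has degree `e_{ρ p}`. -/
def rowWt {σ ι : Type} [DecidableEq ι] (ρ : σ → ι) : σ → (ι → ℕ) := fun p => Pi.single (ρ p) 1

/-- The multidegree of an exponent. -/
def mdeg {σ ι : Type} [DecidableEq ι] (ρ : σ → ι) (u : σ →₀ ℕ) : ι → ℕ :=
  Finsupp.weight (rowWt ρ) u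

section mdeg
variable {σ ι : Type} [DecidableEq ι] (ρ : σ → ι)

theorem mdeg_add (u w : σ →₀ ℕ) : mdeg ρ (u + w) = mdeg ρ u + mdeg ρ w := map_add _ _ _

theorem mdeg_single (p : σ) (k : ℕ) : mdeg ρ (Finsupp.single p k) = Pi.single (ρ p) k := by
  rw [mdeg, Finsupp.weight_single, rowWt, ← Pi.single_smul]
  simp

theorem mdeg_zero : mdeg ρ 0 = 0 := map_zero _

theorem le_mdeg (u : σ →₀ ℕ) (p : σ) : u p ≤ mdeg ρ u (ρ p) := by
  classical
  have : u = Finsupp.single p (u p) + u.erase p := (Finsupp.single_add_erase p u).symm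
  conv_rhs => rw [this]
  rw [mdeg_add, mdeg_single]
  simp

theorem mdeg_apply [Fintype σ] (u : σ →₀ ℕ) (i : ι) :
    mdeg ρ u i = ∑ p with ρ p = i, u p := by
  rw [mdeg, Finsupp.weight_apply, Finsupp.sum_fintype _ _ (by simp), Finset.sum_apply,
    Finset.sum_filter]
  refine Finset.sum_congr rfl fun p _ => ?_
  by_cases h : ρ p = i
  · subst h; simp [rowWt]
  · simp [rowWt, h, Ne.symm h]

theorem finite_mdeg_eq [Finite σ] (a : ι → ℕ) : {u : σ →₀ ℕ | mdeg ρ u = a}.Finite := by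
  classical
  have := Fintype.ofFinite σ
  refine Set.Finite.subset (Set.finite_Iic (Finsupp.equivFunOnFinite.symm fun p => a (ρ p))) ?_
  rintro u rfl p
  exact le_mdeg ρ u p

theorem finite_of_mdeg [Finite σ] {s : Set (σ →₀ ℕ)} (a : ι → ℕ) (h : ∀ u ∈ s, mdeg ρ u = a) :
    s.Finite := (finite_mdeg_eq ρ a).subset h

theorem mdeg_eq_of_mem_support {K : Type} [Field K] {f : MvPolynomial σ K} {a : ι → ℕ}
    (hf : f.IsWeightedHomogeneous (rowWt ρ) a) {u : σ →₀ ℕ} (hu : u ∈ f.support) :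
    mdeg ρ u = a := hf (MvPolynomial.mem_support_iff.1 hu)

end mdeg

section gh
variable {σ ι K : Type} [DecidableEq ι] [Field K] (ρ : σ → ι)

/-- The homogeneous component of degree `a` of the ideal `I`. -/
def ghSub (I : Ideal (MvPolynomial σ K)) (a : ι → ℕ) : Submodule K (MvPolynomial σ K) :=
  Submodule.restrictScalars K I ⊓ weightedHomogeneousSubmodule K (rowWt ρ) a

/-- The multigraded Hilbert function of the ideal `I`. -/
def gh (I : Ideal (MvPolynomial σ K)) (a : ι → ℕ) : ℕ := Module.finrank K (ghSub ρ I a)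

theorem hilb_eq_gh {v : ℕ} {n : Fin v → ℕ} (I : Ideal (MvPolynomial (MVar v n) K))
    (a : Fin v → ℕ) : hilb I a = gh (Sigma.fst : MVar v n → Fin v) I a := rfl

theorem gh_eq_ncard_leadSet [Finite σ] {α : Type} [LinearOrder α]
    {key : (σ →₀ ℕ) → α} (hkey : Function.Injective key) (I : Ideal (MvPolynomial σ K))
    (a : ι → ℕ) : gh ρ I a = (leadSet key (ghSub ρ I a)).ncard :=
  finrank_eq_ncard_leadSet hkey _ (finite_mdeg_eq ρ a)
    fun _ hf _ hu => mdeg_eq_of_mem_support ρ hf.2 hu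

instance finite_ghSub [Finite σ] (I : Ideal (MvPolynomial σ K)) (a : ι → ℕ) :
    Module.Finite K (ghSub ρ I a) := by
  have := (finite_mdeg_eq ρ a).to_subtype
  let φ : ghSub ρ I a →ₗ[K] ({u : σ →₀ ℕ | mdeg ρ u = a} → K) :=
    LinearMap.pi fun t => (MvPolynomial.lcoeff K t.1) ∘ₗ (ghSub ρ I a).subtype
  refine Module.Finite.of_injective φ ?_
  rw [injective_iff_map_eq_zero]
  rintro ⟨f, hf⟩ h0
  ext u
  by_cases hu : u ∈ f.support
  · exact congrFun h0 ⟨u, mdeg_eq_of_mem_support ρ hf.2 hu⟩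
  · simpa using hu

/-- Hilbert function of an ideal spanned by monomials. -/
theorem gh_eq_ncard_of_mem_iff [Finite σ] (I : Ideal (MvPolynomial σ K)) (E : Set (σ →₀ ℕ))
    (hE : ∀ f, f ∈ I ↔ ∀ u ∈ f.support, u ∈ E) (a : ι → ℕ) :
    gh ρ I a = {u | mdeg ρ u = a ∧ u ∈ E}.ncard := by
  classical
  have := Fintype.ofFinite σ
  obtain ⟨key, hinj, -⟩ := exists_key (0 : (σ →₀ ℕ) →+ ℤ)
  rw [gh_eq_ncard_leadSet ρ hinj]
  congr 1
  ext u
  constructor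
  · rintro ⟨f, hf, hu, -⟩
    exact ⟨mdeg_eq_of_mem_support ρ hf.2 hu, (hE f).1 hf.1 u hu⟩
  · rintro ⟨rfl, hu⟩
    refine ⟨monomial u 1, ⟨(hE _).2 ?_, isWeightedHomogeneous_monomial _ _ _ rfl⟩, ?_, ?_⟩ <;>
      simp [hu]

/-- Graded automorphisms preserve the Hilbert function. -/
theorem gh_comap_algEquiv (e : MvPolynomial σ K ≃ₐ[K] MvPolynomial σ K)
    (he : ∀ f a, f.IsWeightedHomogeneous (rowWt ρ) a → (e f).IsWeightedHomogeneous (rowWt ρ) a)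
    (he' : ∀ f a, f.IsWeightedHomogeneous (rowWt ρ) a →
      (e.symm f).IsWeightedHomogeneous (rowWt ρ) a)
    (I : Ideal (MvPolynomial σ K)) (a : ι → ℕ) :
    gh ρ (I.comap e) a = gh ρ I a := by
  have h : (ghSub ρ (I.comap e) a).map e.toLinearMap = ghSub ρ I a := by
    ext f
    constructor
    · rintro ⟨g, hg, rfl⟩
      exact ⟨hg.1, he _ _ hg.2⟩
    · intro hf
      refine ⟨e.symm f, ⟨?_, he' _ _ hf.2⟩, by simp⟩
      change e (e.symm f) ∈ I
      simpa using hf.1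
  rw [gh, gh, ← h]
  exact (LinearEquiv.finrank_map_eq e.toLinearEquiv _).symm

end gh

/-- The type of a set of variables: the number of its elements in each row. -/
def ftype {σ ι : Type} [DecidableEq ι] (ρ : σ → ι) (F : Finset σ) : ι → ℕ :=
  fun i => (F.filter fun p => ρ p = i).card

theorem coe_mapDomain_eq_mdeg {σ ι : Type} [DecidableEq ι] (ρ : σ → ι) (u : σ →₀ ℕ) :
    ⇑(u.mapDomain ρ) = mdeg ρ u := by
  induction u using Finsupp.induction_linear with
  | zero => simp [mdeg_zero]
  | add f g hf hg => rw [Finsupp.mapDomain_add, Finsupp.coe_add, hf, hg, mdeg_add]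
  | single p k => rw [Finsupp.mapDomain_single, mdeg_single, Finsupp.single_eq_pi_single]

section GF
variable {σ ι : Type} [Fintype σ] [DecidableEq σ] [DecidableEq ι] (ρ : σ → ι)

theorem finite_mapDomain_eq (A : Set (σ →₀ ℕ)) (m : ι →₀ ℕ) :
    {u ∈ A | u.mapDomain ρ = m}.Finite :=
  finite_of_mdeg ρ m fun u hu => by rw [← coe_mapDomain_eq_mdeg, hu.2]

/-- The multigraded generating function of a set of exponents. -/
def genFun (A : Set (σ →₀ ℕ)) : MvPowerSeries ι ℤ :=
  fun m => ({u ∈ A | u.mapDomain ρ = m}.ncard : ℤ)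

theorem coeff_genFun (A : Set (σ →₀ ℕ)) (m : ι →₀ ℕ) :
    MvPowerSeries.coeff m (genFun ρ A) = ({u ∈ A | u.mapDomain ρ = m}.ncard : ℤ) := rfl

theorem genFun_union {A B : Set (σ →₀ ℕ)} (h : Disjoint A B) :
    genFun ρ (A ∪ B) = genFun ρ A + genFun ρ B := by
  ext m
  rw [map_add, coeff_genFun, coeff_genFun, coeff_genFun, ← Nat.cast_add,
    ← Set.ncard_union_eq _ (finite_mapDomain_eq ρ _ _) (finite_mapDomain_eq ρ _ _)]
  · congr 2
    ext u
    simp [or_and_right]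
  · exact Set.disjoint_left.2 fun u hu hu' => Set.disjoint_left.1 h hu.1 hu'.1

theorem genFun_empty : genFun ρ (∅ : Set (σ →₀ ℕ)) = 0 := by
  ext m
  simp [coeff_genFun]

theorem genFun_biUnion {τ : Type} (T : Finset τ) (A : τ → Set (σ →₀ ℕ))
    (h : ∀ s ∈ T, ∀ t ∈ T, s ≠ t → Disjoint (A s) (A t)) :
    genFun ρ (⋃ t ∈ T, A t) = ∑ t ∈ T, genFun ρ (A t) := by
  classical
  induction T using Finset.induction_on with
  | empty => simp [genFun_empty]
  | insert t T ht ih =>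
    rw [Finset.set_biUnion_insert, genFun_union, Finset.sum_insert ht, ih]
    · exact fun s hs t ht => h s (Finset.mem_insert_of_mem hs) t (Finset.mem_insert_of_mem ht)
    · rw [Set.disjoint_iUnion₂_right]
      exact fun s hs => h t (Finset.mem_insert_self _ _) s (Finset.mem_insert_of_mem hs)
        fun e => ht (e ▸ hs)

theorem genFun_shift (A : Set (σ →₀ ℕ)) (x : σ) :
    genFun ρ ((· + Finsupp.single x 1) '' A) = MvPowerSeries.X (ρ x) * genFun ρ A := by
  ext m
  rw [MvPowerSeries.X_def, MvPowerSeries.coeff_monomial_mul, coeff_genFun, one_mul, coeff_genFun]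
  have key : {u ∈ (· + Finsupp.single x 1) '' A | u.mapDomain ρ = m} =
      (· + Finsupp.single x 1) '' {u ∈ A | u.mapDomain ρ + Finsupp.single (ρ x) 1 = m} := by
    ext u
    constructor
    · rintro ⟨⟨w, hw, rfl⟩, h⟩
      exact ⟨w, ⟨hw, by simpa [Finsupp.mapDomain_add] using h⟩, rfl⟩
    · rintro ⟨w, ⟨hw, h⟩, rfl⟩
      exact ⟨⟨w, hw, rfl⟩, by simpa [Finsupp.mapDomain_add] using h⟩
  rw [key, Set.ncard_image_of_injective _ (add_left_injective _)]
  split_ifs with h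
  · congr 2
    ext u
    simp only [Set.mem_ofPred_eq, eq_tsub_iff_add_eq_of_le h]
  · rw [Nat.cast_eq_zero, Set.ncard_eq_zero ((finite_mapDomain_eq ρ A
      (m - Finsupp.single (ρ x) 1)).subset fun u hu => ⟨hu.1, by rw [← hu.2]; simp⟩)]
    refine Set.eq_empty_of_forall_notMem fun u hu => h ?_
    rw [← hu.2]
    exact le_add_self

/-- The exponents obtained from `b` by adding exponents supported on `G`. -/
def cyl (b : σ →₀ ℕ) (G : Finset σ) : Set (σ →₀ ℕ) := {u | ∃ t, t.support ⊆ G ∧ u = b + t}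

theorem cyl_insert (b : σ →₀ ℕ) {G : Finset σ} (x : σ) :
    cyl b (insert x G) = cyl b G ∪ (· + Finsupp.single x 1) '' cyl b (insert x G) := by
  ext u
  constructor
  · rintro ⟨t, ht, rfl⟩
    by_cases hx : t x = 0
    · left
      refine ⟨t, fun p hp => ?_, rfl⟩
      rcases Finset.mem_insert.1 (ht hp) with rfl | h
      · simp [hx] at hp
      · exact h
    · right
      have hle : Finsupp.single x 1 ≤ t := Finsupp.single_le_iff.2 (Nat.one_le_iff_ne_zero.2 hx)
      refine ⟨b + (t - Finsupp.single x 1), ⟨_, ?_, rfl⟩, ?_⟩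
      · exact (Finsupp.support_mono tsub_le_self).trans ht
      · simp only [add_assoc, tsub_add_cancel_of_le hle]
  · rintro (⟨t, ht, rfl⟩ | ⟨w, ⟨t, ht, rfl⟩, rfl⟩)
    · exact ⟨t, ht.trans (Finset.subset_insert _ _), rfl⟩
    · refine ⟨t + Finsupp.single x 1, ?_, add_assoc _ _ _⟩
      refine Finsupp.support_add.trans (Finset.union_subset ht ?_)
      exact (Finsupp.support_single_subset).trans (by simp)

theorem genFun_cyl (b : σ →₀ ℕ) (G : Finset σ) :
    genFun ρ (cyl b G) * ∏ x ∈ G, (1 - MvPowerSeries.X (ρ x)) =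
      MvPowerSeries.monomial (b.mapDomain ρ) 1 := by
  induction G using Finset.induction_on with
  | empty =>
    ext m
    have : cyl b ∅ = {b} := by
      ext u
      simp [cyl]
    rw [this, Finset.prod_empty, mul_one, coeff_genFun, MvPowerSeries.coeff_monomial]
    split_ifs with h
    · have : {u ∈ ({b} : Set (σ →₀ ℕ)) | u.mapDomain ρ = m} = {b} := by
        ext u
        simp only [Set.mem_singleton_iff, Set.mem_ofPred_eq, and_iff_left_iff_imp]
        rintro rfl
        exact h.symm
      rw [this]
      simp
    · have : {u ∈ ({b} : Set (σ →₀ ℕ)) | u.mapDomain ρ = m} = ∅ := by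
        ext u
        simp only [Set.mem_singleton_iff, Set.mem_ofPred_eq, Set.mem_empty_iff_false, iff_false]
        rintro ⟨rfl, rfl⟩
        exact h rfl
      rw [this]
      simp
  | insert x G hx ih =>
    have hd : Disjoint (cyl b G) ((· + Finsupp.single x 1) '' cyl b (insert x G)) := by
      rw [Set.disjoint_left]
      rintro u ⟨t, ht, rfl⟩ ⟨w, ⟨t', ht', rfl⟩, h⟩
      have h1 := DFunLike.congr_fun h x
      have h2 : t x = 0 := Finsupp.notMem_support_iff.1 fun h => hx (ht h)
      simp [h2] at h1
      omega
    have h := congrArg (genFun ρ) (cyl_insert b (G := G) x)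
    rw [genFun_union ρ hd, genFun_shift] at h
    rw [Finset.prod_insert hx, ← mul_assoc, ← ih]
    congr 1
    linear_combination h

/-- The constant exponent. -/
def constExp (σ : Type) [Fintype σ] (s : ℕ) : σ →₀ ℕ := Finsupp.equivFunOnFinite.symm fun _ => s

@[simp] theorem constExp_apply (s : ℕ) (p : σ) : constExp σ s p = s := rfl

/-- The generating function of a set of exponents determined by truncations at `s`. -/
theorem genFun_mul_prod (D : Set (σ →₀ ℕ)) (s : ℕ) (hD : ∀ u, u ∈ D ↔ u ⊓ constExp σ s ∈ D)
    (T : Finset (σ →₀ ℕ)) (hT : ∀ u, u ∈ T ↔ u ≤ constExp σ s ∧ u ∈ D) :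
    genFun ρ D * ∏ x, (1 - MvPowerSeries.X (ρ x)) =
      ∑ u ∈ T, MvPowerSeries.monomial (u.mapDomain ρ) 1 *
        ∏ x with u x ≠ s, (1 - MvPowerSeries.X (ρ x)) := by
  have hcyl : ∀ u ∈ T, ∀ w, w ∈ cyl u (Finset.univ.filter fun x => u x = s) ↔
      w ⊓ constExp σ s = u := by
    intro u hu w
    have hus := ((hT u).1 hu).1
    constructor
    · rintro ⟨t, ht, rfl⟩
      ext p
      have h1 : u p ≤ s := hus p
      have h2 : t p ≠ 0 → u p = s := fun h => by
        simpa using ht (Finsupp.mem_support_iff.2 h)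
      simp only [Finsupp.inf_apply, Finsupp.add_apply, constExp_apply]
      by_cases h : t p = 0
      · omega
      · have := h2 h
        omega
    · intro h
      have hp : ∀ p, min (w p) s = u p := fun p => DFunLike.congr_fun h p
      refine ⟨w - u, fun p hpt => ?_, ?_⟩
      · have h0 : w p - u p ≠ 0 := by simpa using hpt
        have := hp p
        simp only [Finset.mem_filter, Finset.mem_univ, true_and]
        omega
      · ext p
        have := hp p
        simp only [Finsupp.add_apply, Finsupp.tsub_apply]
        omega
  have hU : D = ⋃ u ∈ T, cyl u (Finset.univ.filter fun x => u x = s) := by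
    ext w
    simp only [Set.mem_iUnion]
    constructor
    · intro hw
      have : w ⊓ constExp σ s ∈ T := (hT _).2 ⟨inf_le_right, (hD w).1 hw⟩
      exact ⟨_, this, (hcyl _ this w).2 rfl⟩
    · rintro ⟨u, hu, hw⟩
      rw [hD, (hcyl u hu w).1 hw]
      exact ((hT u).1 hu).2
  rw [hU, genFun_biUnion, Finset.sum_mul]
  · refine Finset.sum_congr rfl fun u _ => ?_
    rw [← genFun_cyl ρ u (Finset.univ.filter fun x => u x = s), mul_assoc,
      Finset.prod_filter_mul_prod_filter_not]
  · intro u hu w hw hne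
    rw [Set.disjoint_left]
    intro t h1 h2
    exact hne (((hcyl u hu t).1 h1).symm.trans ((hcyl w hw t).1 h2))

omit [DecidableEq σ] in
theorem exists_truncation (E : Set (σ →₀ ℕ)) (hE : IsUpperSet E) :
    ∃ s, 1 ≤ s ∧ ∀ u, u ∈ E ↔ u ⊓ constExp σ s ∈ E := by
  have hanti : IsAntichain (· ≤ ·) {u | Minimal (· ∈ E) u} := setOfPred_minimal_antichain _
  have hfin : {u | Minimal (· ∈ E) u}.Finite :=
    hanti.finite_of_partiallyWellOrderedOn (Set.isPWO_of_wellQuasiOrderedLE _)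
  obtain ⟨c, hc⟩ := hfin.bddAbove
  refine ⟨∑ p, c p + 1, by omega, fun u => ⟨fun hu => ?_, fun h => hE inf_le_left h⟩⟩
  obtain ⟨w, hwu, hw⟩ := exists_minimal_le_of_wellFoundedLT (· ∈ E) u hu
  refine hE (le_inf hwu fun p => ?_) hw.1
  have h1 : w p ≤ c p := hc hw p
  have h2 : c p ≤ ∑ p, c p := Finset.single_le_sum (fun _ _ => Nat.zero_le _) (Finset.mem_univ p)
  simp only [constExp_apply]
  omega

/-- The exponent counting the elements outside a set in each row. -/
def coExp (F : Finset σ) : ι →₀ ℕ := ∑ x with x ∉ F, Finsupp.single (ρ x) 1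

theorem coExp_add_ftype (F : Finset σ) (i : ι) :
    coExp ρ F i + ftype ρ F i = (Finset.univ.filter fun p => ρ p = i).card := by
  have h1 : coExp ρ F i = ((Finset.univ.filter fun p => ρ p = i).filter fun p => p ∉ F).card := by
    rw [coExp, Finsupp.finsetSum_apply, Finset.filter_filter, Finset.card_filter, Finset.sum_filter]
    refine Finset.sum_congr rfl fun p _ => ?_
    rw [Finsupp.single_apply]
    by_cases h : p ∈ F <;> by_cases h' : ρ p = i <;> simp [h, h']
  have h2 : ftype ρ F i = ((Finset.univ.filter fun p => ρ p = i).filter fun p => p ∈ F).card := by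
    rw [ftype]
    congr 1
    ext p
    simp [and_comm]
  rw [h1, h2, add_comm, Finset.card_filter_add_card_filter_not]

theorem coExp_le_iff {F G : Finset σ} : coExp ρ F ≤ coExp ρ G ↔ ftype ρ G ≤ ftype ρ F := by
  rw [Finsupp.le_def, Pi.le_def]
  refine forall_congr' fun i => ?_
  have h1 := coExp_add_ftype ρ F i
  have h2 := coExp_add_ftype ρ G i
  omega

/-- The substitution of `1 - X i` for `X i`. -/
def flip : MvPolynomial ι ℤ →ₐ[ℤ] MvPolynomial ι ℤ := aeval fun i => 1 - X i

omit [DecidableEq ι] in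
theorem coeff_zero_flip_monomial (m : ι →₀ ℕ) :
    coeff 0 (flip (monomial m 1) : MvPolynomial ι ℤ) = 1 := by
  rw [← constantCoeff_eq, flip, aeval_monomial, map_mul, Finsupp.prod, map_prod]
  simp

theorem flip_prod (G : Finset σ) :
    (flip (∏ x with x ∉ G, (1 - X (ρ x))) : MvPolynomial ι ℤ) = monomial (coExp ρ G) 1 := by
  rw [map_prod, coExp, monomial_sum_one]
  refine Finset.prod_congr rfl fun x _ => ?_
  rw [flip, map_sub, map_one, aeval_X, sub_sub_cancel, X]

/-- The numerator of the generating function, after substituting `1 - X i` for `X i`. -/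
theorem exists_numerator (D : Set (σ →₀ ℕ)) (s : ℕ)
    (hD : ∀ u, u ∈ D ↔ u ⊓ constExp σ s ∈ D)
    (T : Finset (σ →₀ ℕ)) (hT : ∀ u, u ∈ T ↔ u ≤ constExp σ s ∧ u ∈ D) :
    ∃ P : MvPolynomial ι ℤ,
      (P : MvPowerSeries ι ℤ) = genFun ρ D * ∏ x, (1 - MvPowerSeries.X (ρ x)) ∧
      flip P = ∑ u ∈ T, flip (monomial (u.mapDomain ρ) 1) *
        monomial (coExp ρ (Finset.univ.filter fun x => u x = s)) 1 := by
  refine ⟨∑ u ∈ T, monomial (u.mapDomain ρ) 1 *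
    ∏ x with x ∉ Finset.univ.filter fun x => u x = s, (1 - X (ρ x)), ?_, ?_⟩
  · rw [genFun_mul_prod ρ D s hD T hT, ← MvPolynomial.coeToMvPowerSeries.ringHom_apply, map_sum]
    refine Finset.sum_congr rfl fun u _ => ?_
    rw [map_mul, map_prod]
    simp only [map_sub, map_one, MvPolynomial.coeToMvPowerSeries.ringHom_apply,
      MvPolynomial.coe_monomial, MvPolynomial.coe_X]
    refine congrArg _ (Finset.prod_congr (by ext; simp) fun x _ => rfl)
  · rw [map_sum]
    refine Finset.sum_congr rfl fun u _ => ?_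
    rw [map_mul, flip_prod]

/-- Types of faces of a complex occur, up to enlarging, among coordinate cylinders in the
complement of any up-set of exponents with the same Hilbert function. -/
theorem exists_ftype_le (Δ : Set (Finset σ)) (E : Set (σ →₀ ℕ)) (hE : IsUpperSet E)
    (h : ∀ a, {u | mdeg ρ u = a ∧ u.support ∈ Δ}.ncard = {u | mdeg ρ u = a ∧ u ∉ E}.ncard)
    {F : Finset σ} (hF : F ∈ Δ) :
    ∃ G : Finset σ, (∀ w : σ →₀ ℕ, w.support ⊆ G → w ∉ E) ∧ ftype ρ F ≤ ftype ρ G := by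
  obtain ⟨s, hs1, hs⟩ := exists_truncation E hE
  set D : Set (σ →₀ ℕ) := {u | u.support ∈ Δ}
  have hgen : genFun ρ D = genFun ρ Eᶜ := by
    ext m
    rw [coeff_genFun, coeff_genFun]
    have := h m
    simp only [← coe_mapDomain_eq_mdeg, DFunLike.coe_fn_eq] at this
    simpa [D, and_comm] using this
  have hDt : ∀ u, u ∈ D ↔ u ⊓ constExp σ 1 ∈ D := by
    intro u
    have : (u ⊓ constExp σ 1).support = u.support := by
      ext p
      simp
    simp [D, this]
  have hEt : ∀ u, u ∈ Eᶜ ↔ u ⊓ constExp σ s ∈ Eᶜ := fun u => not_congr (hs u)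
  have hfin : ∀ (A : Set (σ →₀ ℕ)) (c : σ →₀ ℕ), ∃ T : Finset (σ →₀ ℕ),
      ∀ u, u ∈ T ↔ u ≤ c ∧ u ∈ A := fun A c =>
    ⟨((Set.finite_Iic c).inter_of_left A).toFinset, fun u => by simp⟩
  obtain ⟨T₁, hT₁⟩ := hfin D (constExp σ 1)
  obtain ⟨T₂, hT₂⟩ := hfin Eᶜ (constExp σ s)
  obtain ⟨P₁, hP₁, hQ₁⟩ := exists_numerator ρ D 1 hDt T₁ hT₁
  obtain ⟨P₂, hP₂, hQ₂⟩ := exists_numerator ρ Eᶜ s hEt T₂ hT₂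
  have hP : P₁ = P₂ := MvPolynomial.coe_injective ι ℤ (by rw [hP₁, hP₂, hgen])
  obtain ⟨F₀, ⟨hF₀, hle⟩, hmax⟩ := (Set.toFinite {G ∈ Δ | ftype ρ F ≤ ftype ρ G}).exists_maximalFor
    (ftype ρ) _ ⟨F, hF, le_rfl⟩
  have hpos : 0 < coeff (coExp ρ F₀) (flip P₁) := by
    rw [hQ₁, coeff_sum]
    have hsupp : ∀ u ∈ T₁, (Finset.univ.filter fun x => u x = 1) = u.support := by
      intro u hu
      ext p
      have : u p ≤ 1 := ((hT₁ u).1 hu).1 p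
      simp
      omega
    have hterm : ∀ u ∈ T₁, coExp ρ u.support ≤ coExp ρ F₀ →
        coExp ρ u.support = coExp ρ F₀ := by
      intro u hu hc
      refine le_antisymm hc ((coExp_le_iff ρ).2 ?_)
      have h1 := (coExp_le_iff ρ).1 hc
      exact hmax ⟨((hT₁ u).1 hu).2, hle.trans h1⟩ h1
    refine Finset.sum_pos' (fun u hu => ?_)
      ⟨Finsupp.indicator F₀ fun _ _ => 1, (hT₁ _).2 ⟨fun p => ?_, ?_⟩, ?_⟩
    · rw [hsupp u hu, coeff_mul_monomial']
      split_ifs with hc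
      · rw [hterm u hu hc, tsub_self, coeff_zero_flip_monomial, one_mul]
        exact zero_le_one
      · exact le_rfl
    · simp only [Finsupp.indicator_apply, constExp_apply]
      split_ifs <;> omega
    · have : (Finsupp.indicator F₀ fun _ _ => 1 : σ →₀ ℕ).support = F₀ := by
        ext p
        simp [Finsupp.indicator_apply]
      simpa [D, this] using hF₀
    · have : (Finset.univ.filter fun x => (Finsupp.indicator F₀ fun _ _ => 1 : σ →₀ ℕ) x = 1) =
          F₀ := by
        ext p
        simp [Finsupp.indicator_apply]
      rw [this, coeff_mul_monomial', if_pos le_rfl, tsub_self, coeff_zero_flip_monomial]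
      norm_num
  rw [hP, hQ₂, coeff_sum] at hpos
  obtain ⟨u, hu, hne⟩ := Finset.exists_ne_zero_of_sum_ne_zero hpos.ne'
  rw [coeff_mul_monomial'] at hne
  have hc := (coExp_le_iff ρ).1 (by_contra fun hc => hne (if_neg hc) :
    coExp ρ (Finset.univ.filter fun x => u x = s) ≤ coExp ρ F₀)
  refine ⟨_, fun w hw hwE => ?_, hle.trans hc⟩
  refine ((hT₂ u).1 hu).2 (hE (fun p => ?_) ((hs w).1 hwE))
  by_cases hp : p ∈ w.support
  · have : u p = s := by simpa using hw hp
    rw [this]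
    exact inf_le_right
  · simp [Finsupp.notMem_support_iff.1 hp]

end GF

theorem ncard_le_add_of_injOn {α β γ : Type} {A : Set α} {B : Set β} {C : Set γ} (hB : B.Finite)
    (hC : C.Finite) (P : α → Prop) (f : α → β) (g : α → γ)
    (hf : ∀ a ∈ A, P a → f a ∈ B) (hg : ∀ a ∈ A, ¬ P a → g a ∈ C)
    (hfi : ∀ a ∈ A, P a → ∀ a' ∈ A, P a' → f a = f a' → a = a')
    (hgi : ∀ a ∈ A, ¬ P a → ∀ a' ∈ A, ¬ P a' → g a = g a' → a = a') :
    A.ncard ≤ B.ncard + C.ncard := by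
  have h1 : {a ∈ A | P a}.ncard ≤ B.ncard :=
    Set.ncard_le_ncard_of_injOn f (fun a ha => hf a ha.1 ha.2)
      (fun a ha a' ha' h => hfi a ha.1 ha.2 a' ha'.1 ha'.2 h) hB
  have h2 : {a ∈ A | ¬ P a}.ncard ≤ C.ncard :=
    Set.ncard_le_ncard_of_injOn g (fun a ha => hg a ha.1 ha.2)
      (fun a ha a' ha' h => hgi a ha.1 ha.2 a' ha'.1 ha'.2 h) hC
  have h3 : A = {a ∈ A | P a} ∪ {a ∈ A | ¬ P a} := by
    ext a
    by_cases h : P a <;> simp [h]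
  calc A.ncard ≤ {a ∈ A | P a}.ncard + {a ∈ A | ¬ P a}.ncard := by
        conv_lhs => rw [h3]
        exact Set.ncard_union_le _ _
    _ ≤ _ := Nat.add_le_add h1 h2

section Rank
variable {v : ℕ} {n : Fin v → ℕ}

/-- In each row, the number of variables from the first element of `F` on. -/
def rk (F : Finset (MVar v n)) : Fin v → ℕ :=
  fun i => (F.filter fun p => p.1 = i).sup fun p => n p.1 + 1 - p.2

theorem rk_le_iff {F : Finset (MVar v n)} {q : Fin v → ℕ} :
    rk F ≤ q ↔ ∀ p ∈ F, n p.1 + 1 - p.2 ≤ q p.1 := by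
  simp only [Pi.le_def, rk, Finset.sup_le_iff, Finset.mem_filter]
  exact ⟨fun h p hp => h p.1 p ⟨hp, rfl⟩, fun h i p hp => hp.2 ▸ h p hp.1⟩

theorem le_rk {F : Finset (MVar v n)} {p : MVar v n} (hp : p ∈ F) :
    n p.1 + 1 - p.2 ≤ rk F p.1 := rk_le_iff.1 le_rfl p hp

theorem rk_mono {F G : Finset (MVar v n)} (h : F ⊆ G) : rk F ≤ rk G :=
  rk_le_iff.2 fun _ hp => le_rk (h hp)

theorem exists_rk_eq {F : Finset (MVar v n)} {i : Fin v} (h : rk F i ≠ 0) :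
    ∃ p ∈ F, p.1 = i ∧ rk F i = n p.1 + 1 - p.2 := by
  have hne : (F.filter fun p => p.1 = i).Nonempty := by
    by_contra hc
    rw [Finset.not_nonempty_iff_eq_empty] at hc
    exact h (by rw [rk, hc, Finset.sup_empty]; rfl)
  obtain ⟨p, hp, hs⟩ := Finset.exists_mem_eq_sup _ hne fun p : MVar v n => n p.1 + 1 - p.2
  rw [Finset.mem_filter] at hp
  exact ⟨p, hp.1, hp.2, hs⟩

theorem rk_eq_zero_iff {F : Finset (MVar v n)} : rk F = 0 ↔ F = ∅ := by
  constructor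
  · intro h
    refine Finset.eq_empty_of_forall_notMem fun p hp => ?_
    have h1 := le_rk hp
    rw [h] at h1
    have := p.2.2
    simp at h1
    omega
  · rintro rfl
    exact funext fun i => rfl

theorem ncard_rk_le (Q Q₁ Q₂ : Set (Fin v → ℕ)) (h₁ : IsLowerSet Q₁) (h₂ : IsLowerSet Q₂)
    (hQ : Q ⊆ Q₁ ∪ Q₂) (i : Fin v) (hi : ∀ q ∈ Q₁, q - Pi.single i 1 ∈ Q₂) (a : Fin v → ℕ) :
    {u : MVar v n →₀ ℕ | mdeg Sigma.fst u = a ∧ rk u.support ∈ Q}.ncard ≤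
      {u : MVar v n →₀ ℕ | mdeg Sigma.fst u + Pi.single i 1 = a ∧ rk u.support ∈ Q₁}.ncard +
      {u : MVar v n →₀ ℕ | mdeg Sigma.fst u = a ∧ rk u.support ∈ Q₂}.ncard := by
  classical
  have hex : ∀ u : MVar v n →₀ ℕ, ∃ p : MVar v n, rk u.support i ≠ 0 →
      p ∈ u.support ∧ p.1 = i ∧ rk u.support i = n p.1 + 1 - p.2 := by
    intro u
    by_cases h : rk u.support i = 0
    · exact ⟨⟨i, 0⟩, fun h' => (h' h).elim⟩
    · obtain ⟨p, h1, h2, h3⟩ := exists_rk_eq h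
      exact ⟨p, fun _ => ⟨h1, h2, h3⟩⟩
  choose pt hpt using hex
  have hne : ∀ u : MVar v n →₀ ℕ, rk u.support ∈ Q₁ → rk u.support ∉ Q₂ →
      rk u.support i ≠ 0 := by
    intro u h1 h2 h0
    refine h2 ?_
    have := hi _ h1
    convert this using 1
    funext j
    by_cases hj : j = i
    · subst hj; simp [h0]
    · simp [hj]
  have hmem₁ : ∀ u : MVar v n →₀ ℕ, rk u.support ∈ Q → ¬ rk u.support ∈ Q₂ →
      rk u.support ∈ Q₁ := fun u hu h => (hQ hu).resolve_right h
  have hsplit : ∀ u : MVar v n →₀ ℕ, rk u.support ∈ Q → ¬ rk u.support ∈ Q₂ →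
      u - Finsupp.single (pt u) 1 + Finsupp.single (pt u) 1 = u := by
    intro u hu h
    have h3 := (hpt u (hne u (hmem₁ u hu h) h)).1
    exact tsub_add_cancel_of_le (Finsupp.single_le_iff.2
      (Nat.one_le_iff_ne_zero.2 (Finsupp.mem_support_iff.1 h3)))
  have hkey : ∀ u u' : MVar v n →₀ ℕ, rk u.support ∈ Q → rk u.support ∉ Q₂ →
      rk u'.support ∈ Q → rk u'.support ∉ Q₂ →
      u - Finsupp.single (pt u) 1 = u' - Finsupp.single (pt u') 1 →
      (pt u).2.1 < (pt u').2.1 → False := by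
    intro u u' hu h hu' h' heq hlt
    have hp := hpt u (hne u (hmem₁ u hu h) h)
    have hp' := hpt u' (hne u' (hmem₁ u' hu' h') h')
    refine h' (h₂ (rk_le_iff.2 fun p hpu => ?_) (hi _ (hmem₁ u hu h)))
    have hlt' : n (pt u').1 + 1 - (pt u').2 < rk u.support i := by
      have h1 := hp.2.2
      have h2 := hp'.2.1
      have h3 := (pt u').2.2
      have h4 : n (pt u').1 = n (pt u).1 := by rw [hp.2.1, hp'.2.1]
      omega
    by_cases hpi : p.1 = i
    · have h1 := le_rk hpu
      have h2 : rk u'.support p.1 = rk u'.support i := by rw [hpi]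
      rw [h2, hp'.2.2] at h1
      have h3 : (rk u.support - Pi.single i 1 : Fin v → ℕ) p.1 = rk u.support i - 1 := by
        rw [congrArg (rk u.support - Pi.single i 1 : Fin v → ℕ) hpi, Pi.sub_apply,
          Pi.single_eq_same]
      rw [h3]
      omega
    · simp only [Pi.sub_apply, Pi.single_eq_of_ne hpi, tsub_zero]
      refine le_rk ?_
      have h1 := hsplit u hu h
      have h2 := hsplit u' hu' h'
      rw [← heq] at h2
      have h3 := DFunLike.congr_fun h1 p
      have h4 := DFunLike.congr_fun h2 p
      have h5 : pt u ≠ p := fun e => hpi (e ▸ hp.2.1)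
      have h6 : pt u' ≠ p := fun e => hpi (e ▸ hp'.2.1)
      simp only [Finsupp.add_apply, Finsupp.single_eq_of_ne' h5, Finsupp.single_eq_of_ne' h6,
        add_zero] at h3 h4
      rw [Finsupp.mem_support_iff, ← h3, h4]
      exact Finsupp.mem_support_iff.1 hpu
  have hfin : {u : MVar v n →₀ ℕ | mdeg Sigma.fst u + Pi.single i 1 = a ∧
      rk u.support ∈ Q₁}.Finite :=
    finite_of_mdeg Sigma.fst (a - Pi.single i 1) fun u hu => by rw [← hu.1, add_tsub_cancel_right]
  refine ncard_le_add_of_injOn hfin (finite_of_mdeg Sigma.fst a fun u hu => hu.1)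
    (fun u => rk u.support ∉ Q₂)
    (fun u => u - Finsupp.single (pt u) 1) id ?_ ?_ ?_ ?_
  · rintro u ⟨hu, hQu⟩ h
    have hp := hpt u (hne u (hmem₁ u hQu h) h)
    refine ⟨?_, h₁ (rk_mono (Finsupp.support_mono tsub_le_self)) (hmem₁ u hQu h)⟩
    conv_rhs => rw [← hu, ← hsplit u hQu h, mdeg_add, mdeg_single, hp.2.1]
  · rintro u ⟨hu, hQu⟩ h
    exact ⟨hu, not_not.1 h⟩
  · rintro u ⟨-, hu⟩ h u' ⟨-, hu'⟩ h' heq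
    have hp := hpt u (hne u (hmem₁ u hu h) h)
    have hp' := hpt u' (hne u' (hmem₁ u' hu' h') h')
    have h1 := fun hlt => hkey u u' hu h hu' h' heq hlt
    have h2 := fun hlt => hkey u' u hu' h' hu h heq.symm hlt
    have h3 : (pt u).2.1 = (pt u').2.1 := le_antisymm (not_lt.1 h2) (not_lt.1 h1)
    have h4 : pt u = pt u' := by
      generalize pt u = p at *
      generalize pt u' = p' at *
      obtain ⟨i1, j1⟩ := p
      obtain ⟨i2, j2⟩ := p'
      obtain rfl : i1 = i := hp.2.1
      obtain rfl : i2 = i1 := hp'.2.1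
      simp only [Sigma.mk.injEq, heq_eq_eq, true_and]
      exact Fin.ext h3
    rw [← hsplit u hu h, ← hsplit u' hu' h']
    rw [heq, h4]
  · exact fun u _ _ u' _ _ h => h

/-- The down-closure of the set of types of elements of `Δ`. -/
def types (Δ : Set (Finset (MVar v n))) : Set (Fin v → ℕ) :=
  {q | ∃ F ∈ Δ, q ≤ ftype Sigma.fst F}

theorem isLowerSet_types (Δ : Set (Finset (MVar v n))) : IsLowerSet (types Δ) :=
  fun _ _ h ⟨F, hF, hq⟩ => ⟨F, hF, h.trans hq⟩

/-- The star of a vertex. -/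
def star (Δ : Set (Finset (MVar v n))) (x : MVar v n) : Set (Finset (MVar v n)) :=
  {F | insert x F ∈ Δ}

/-- The deletion of a vertex. -/
def del (Δ : Set (Finset (MVar v n))) (x : MVar v n) : Set (Finset (MVar v n)) :=
  {F ∈ Δ | x ∉ F}

theorem ncard_types_le_star_add_del {Δ : Set (Finset (MVar v n))} (hΔ : IsLowerSet Δ)
    (x : MVar v n) (a : Fin v → ℕ) :
    {u : MVar v n →₀ ℕ | mdeg Sigma.fst u = a ∧ rk u.support ∈ types Δ}.ncard ≤
      {u : MVar v n →₀ ℕ | mdeg Sigma.fst u + Pi.single x.1 1 = a ∧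
        rk u.support ∈ types (star Δ x)}.ncard +
      {u : MVar v n →₀ ℕ | mdeg Sigma.fst u = a ∧ rk u.support ∈ types (del Δ x)}.ncard := by
  refine ncard_rk_le _ _ _ (isLowerSet_types _) (isLowerSet_types _) ?_ x.1 ?_ a
  · rintro q ⟨F, hF, hq⟩
    by_cases hx : x ∈ F
    · exact Or.inl ⟨F, by rwa [star, Set.mem_ofPred_eq, Finset.insert_eq_of_mem hx], hq⟩
    · exact Or.inr ⟨F, ⟨hF, hx⟩, hq⟩
  · rintro q ⟨F, hF, hq⟩
    refine ⟨F.erase x, ⟨hΔ ((Finset.erase_subset x F).trans (Finset.subset_insert x F)) hF,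
      Finset.notMem_erase x F⟩, fun i => ?_⟩
    have h1 := hq i
    have h2 : ((F.filter fun p => p.1 = i).erase x).card =
        ftype Sigma.fst (F.erase x) i := by
      rw [ftype, Finset.filter_erase]
    change q i - (Pi.single x.1 1 : Fin v → ℕ) i ≤ ftype Sigma.fst (F.erase x) i
    change q i ≤ (F.filter fun p => p.1 = i).card at h1
    rw [← h2]
    by_cases hi : i = x.1
    · subst hi
      rw [Pi.single_eq_same]
      have h3 := Finset.pred_card_le_card_erase (a := x) (s := F.filter fun p => p.1 = x.1)
      omega
    · rw [Pi.single_eq_of_ne hi, Finset.erase_eq_of_notMem]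
      · simpa using h1
      · simp [Ne.symm hi]

theorem ncard_star_add_del_le (Δ : Set (Finset (MVar v n)))
    (x : MVar v n) (a : Fin v → ℕ) :
    {u : MVar v n →₀ ℕ | mdeg Sigma.fst u + Pi.single x.1 1 = a ∧
        u.support ∈ star Δ x}.ncard +
      {u : MVar v n →₀ ℕ | mdeg Sigma.fst u = a ∧ u.support ∈ del Δ x}.ncard ≤
      {u : MVar v n →₀ ℕ | mdeg Sigma.fst u = a ∧ u.support ∈ Δ}.ncard := by
  rw [← Set.ncard_image_of_injective _ (add_left_injective (Finsupp.single x 1)),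
    ← Set.ncard_union_eq ?_ ?_ ?_]
  · refine Set.ncard_le_ncard ?_ (finite_of_mdeg Sigma.fst a fun u hu => hu.1)
    rintro u (⟨w, ⟨hw, hs⟩, rfl⟩ | ⟨hu, hs⟩)
    · refine ⟨by simp only [mdeg_add, mdeg_single, hw], ?_⟩
      have : (w + Finsupp.single x 1).support = insert x w.support := by
        ext p
        by_cases h : x = p
        · simp [h]
        · simp [Ne.symm h]
      simp only [this]
      exact hs
    · exact ⟨hu, hs.1⟩
  · rw [Set.disjoint_left]
    rintro u ⟨w, -, rfl⟩ h
    refine h.2.2 ?_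
    simp
  · exact (finite_of_mdeg Sigma.fst (a - Pi.single x.1 1)
      fun u hu => by rw [← hu.1, add_tsub_cancel_right]).image _
  · exact finite_of_mdeg Sigma.fst a fun u hu => hu.1

theorem ncard_types_le {Δ : Set (Finset (MVar v n))} (hΔ : IsLowerSet Δ) (a : Fin v → ℕ) :
    {u : MVar v n →₀ ℕ | mdeg Sigma.fst u = a ∧ rk u.support ∈ types Δ}.ncard ≤
      {u : MVar v n →₀ ℕ | mdeg Sigma.fst u = a ∧ u.support ∈ Δ}.ncard := by
  obtain ⟨W, hW⟩ : ∃ W : Finset (MVar v n), ∀ F ∈ Δ, F ⊆ W := ⟨Finset.univ, by simp⟩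
  induction hN : (∑ i, a i) + W.card using Nat.strong_induction_on generalizing Δ a W with
  | _ N ih =>
  subst hN
  rcases W.eq_empty_or_nonempty with rfl | ⟨x, hx⟩
  · refine Set.ncard_le_ncard ?_ (finite_of_mdeg Sigma.fst a fun u hu => hu.1)
    rintro u ⟨hu, F, hF, hq⟩
    obtain rfl := Finset.subset_empty.1 (hW F hF)
    have h0 : rk u.support = 0 := le_antisymm hq (fun _ => Nat.zero_le _)
    rw [rk_eq_zero_iff] at h0
    exact ⟨hu, h0 ▸ hF⟩
  · refine (ncard_types_le_star_add_del hΔ x a).trans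
      ((Nat.add_le_add ?_ ?_).trans (ncard_star_add_del_le Δ x a))
    · by_cases ha : a x.1 = 0
      · have : {u : MVar v n →₀ ℕ | mdeg Sigma.fst u + Pi.single x.1 1 = a ∧
            rk u.support ∈ types (star Δ x)} = ∅ := by
          refine Set.eq_empty_of_forall_notMem fun u hu => ?_
          have := congrFun hu.1 x.1
          simp [ha] at this
        rw [this]
        simp
      · obtain ⟨b, rfl⟩ : ∃ b, a = b + Pi.single x.1 1 := by
          refine ⟨a - Pi.single x.1 1, (tsub_add_cancel_of_le fun j => ?_).symm⟩
          by_cases hj : j = x.1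
          · subst hj
            simp only [Pi.single_eq_same]
            omega
          · simp [hj]
        simp only [add_left_inj]
        refine ih _ ?_ (Δ := star Δ x) (fun F G h (hF : insert x F ∈ Δ) =>
          show insert x G ∈ Δ from hΔ (Finset.insert_subset_insert x h) hF) b W
          (fun F (hF : insert x F ∈ Δ) => (Finset.subset_insert x F).trans (hW _ hF)) rfl
        simp [Finset.sum_add_distrib]
    · refine ih _ ?_ (Δ := del Δ x) (fun F G h hF => ⟨hΔ h hF.1, fun hx => hF.2 (h hx)⟩) a
        (W.erase x)
        (fun F hF => Finset.subset_erase.2 ⟨hW F hF.1, hF.2⟩) rfl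
      have := Finset.card_erase_lt_of_mem hx
      omega

end Rank

section Borel
variable {K : Type} [Field K] {v : ℕ} {n : Fin v → ℕ}

theorem gAct_X (g : ∀ i : Fin v, Matrix (Fin (n i + 1)) (Fin (n i + 1)) K) (p : MVar v n) :
    gAct g (X p) = ∑ k : Fin (n p.1 + 1), C (g p.1 k p.2) * X ⟨p.1, k⟩ := by
  rw [gAct, aeval_X]

theorem gAct_mul (g h : ∀ i : Fin v, Matrix (Fin (n i + 1)) (Fin (n i + 1)) K) :
    (gAct g).comp (gAct h) = gAct fun i => g i * h i := by
  refine MvPolynomial.algHom_ext fun p => ?_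
  rw [AlgHom.comp_apply, gAct_X, gAct_X, map_sum]
  simp only [map_mul, algHom_C, gAct_X, algebraMap_eq, Finset.mul_sum, Matrix.mul_apply, map_sum,
    Finset.sum_mul]
  rw [Finset.sum_comm]
  refine Finset.sum_congr rfl fun k _ => Finset.sum_congr rfl fun l _ => ?_
  ring

theorem gAct_one : gAct (fun i : Fin v => (1 : Matrix (Fin (n i + 1)) (Fin (n i + 1)) K)) =
    AlgHom.id K _ := by
  refine MvPolynomial.algHom_ext fun p => ?_
  rw [gAct_X, Finset.sum_eq_single p.2]
  · simp
  · intro k _ hk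
    rw [Matrix.one_apply_ne hk]
    simp
  · simp

theorem BorelFixed.gAct_mem {J : Ideal (MvPolynomial (MVar v n) K)} (hJ : BorelFixed J)
    {g : ∀ i : Fin v, Matrix (Fin (n i + 1)) (Fin (n i + 1)) K}
    (hg : ∀ i, IsUnit (g i).det)
    (hg' : ∀ (i : Fin v) (k j : Fin (n i + 1)), j < k → g i k j = 0)
    {f : MvPolynomial (MVar v n) K} (hf : f ∈ J) : gAct g f ∈ J := by
  have h := Ideal.mem_map_of_mem (gAct g) hf
  rwa [hJ g hg hg'] at h

theorem BorelFixed.monomial_mem [Infinite K] {J : Ideal (MvPolynomial (MVar v n) K)}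
    (hJ : BorelFixed J) {f : MvPolynomial (MVar v n) K} (hf : f ∈ J) {u : MVar v n →₀ ℕ}
    (hu : u ∈ f.support) : monomial u (1 : K) ∈ J := by
  classical
  by_contra hnot
  obtain ⟨l, hl, hker⟩ := Submodule.exists_le_ker_of_notMem
    (p := Submodule.restrictScalars K J) (v := monomial u (1 : K)) hnot
  have key : ∀ t : MVar v n → K, (∀ p, t p ≠ 0) →
      ∑ w ∈ f.support, coeff w f * l (monomial w 1) * w.prod (fun p k => t p ^ k) = 0 := by
    intro t ht
    have h1 : gAct (fun i => Matrix.diagonal fun j => t ⟨i, j⟩) f ∈ J := by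
      refine hJ.gAct_mem (fun i => ?_) (fun i k j hjk => ?_) hf
      · rw [Matrix.det_diagonal, isUnit_iff_ne_zero]
        exact Finset.prod_ne_zero_iff.2 fun j _ => ht _
      · exact Matrix.diagonal_apply_ne _ hjk.ne'
    have h2 := hker h1
    have h3 : ∀ p : MVar v n, ∑ k : Fin (n p.1 + 1),
        C (Matrix.diagonal (fun j => t ⟨p.1, j⟩) k p.2) * X ⟨p.1, k⟩ =
        (C (t p) * X p : MvPolynomial (MVar v n) K) := by
      intro p
      rw [Finset.sum_eq_single p.2]
      · rw [Matrix.diagonal_apply_eq]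
      · intro k _ hk
        rw [Matrix.diagonal_apply_ne _ hk]
        simp
      · simp
    rw [LinearMap.mem_ker, gAct, funext h3, aeval_def, eval₂_eq, map_sum] at h2
    rw [← h2]
    refine Finset.sum_congr rfl fun w _ => ?_
    have h4 : (algebraMap K (MvPolynomial (MVar v n) K)) (coeff w f) *
        ∏ i ∈ w.support, (C (t i) * X i) ^ w i =
        (coeff w f * w.prod (fun p k => t p ^ k)) • monomial w (1 : K) := by
      simp only [mul_pow, Finset.prod_mul_distrib]
      rw [smul_eq_C_mul, monomial_eq, C_1, one_mul, Finsupp.prod, Finsupp.prod, algebraMap_eq,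
        C_mul, map_prod, mul_assoc]
      simp only [C_pow]
    rw [h4, map_smul, smul_eq_mul]
    ring
  have hP : (∑ w ∈ f.support, monomial w (coeff w f * l (monomial w 1))) *
      ∏ p : MVar v n, X p = 0 := by
    refine MvPolynomial.funext fun t => ?_
    rw [map_zero, map_mul, map_prod, map_sum]
    simp only [eval_X, eval_monomial]
    by_cases ht : ∀ p, t p ≠ 0
    · rw [key t ht, zero_mul]
    · push Not at ht
      obtain ⟨p, hp⟩ := ht
      rw [Finset.prod_eq_zero (Finset.mem_univ p) hp, mul_zero]
  have hP' := (mul_eq_zero.1 hP).resolve_right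
    (Finset.prod_ne_zero_iff.2 fun p _ => X_ne_zero p)
  have h0 := congrArg (coeff u) hP'
  rw [coeff_sum, coeff_zero, Finset.sum_eq_single u] at h0
  · rw [coeff_monomial, if_pos rfl] at h0
    exact (mul_ne_zero (mem_support_iff.1 hu) hl) h0
  · intro w _ hw
    rw [coeff_monomial, if_neg hw]
  · exact fun h => (h hu).elim

theorem _root_.Ideal.IsRadical.monomial_mem_iff {σ : Type} {J : Ideal (MvPolynomial σ K)}
    (hJ : J.IsRadical) (u : σ →₀ ℕ) : monomial u (1 : K) ∈ J ↔ ∏ p ∈ u.support, X p ∈ J := by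
  have hu : monomial u (1 : K) = ∏ p ∈ u.support, X p ^ u p := by
    rw [monomial_eq, C_1, one_mul, Finsupp.prod]
  constructor
  · intro h
    refine hJ ⟨u.degree, J.mem_of_dvd ?_ h⟩
    rw [hu, ← Finset.prod_pow]
    exact Finset.prod_dvd_prod_of_dvd _ _ fun p _ => pow_dvd_pow _ (Finsupp.le_degree p u)
  · refine J.mem_of_dvd ?_
    rw [hu]
    exact Finset.prod_dvd_prod_of_dvd _ _ fun p hp =>
      dvd_pow_self _ (Finsupp.mem_support_iff.1 hp)

/-- The complex of faces of a squarefree monomial ideal. -/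
def faces (J : Ideal (MvPolynomial (MVar v n) K)) : Set (Finset (MVar v n)) :=
  {F | ∏ p ∈ F, X p ∉ J}

theorem isLowerSet_faces (J : Ideal (MvPolynomial (MVar v n) K)) : IsLowerSet (faces J) :=
  fun _ _ h hF hG => hF (J.mem_of_dvd (Finset.prod_dvd_prod_of_subset _ _ _ h) hG)

theorem mem_iff_support_notMem_faces [Infinite K] {J : Ideal (MvPolynomial (MVar v n) K)}
    (hB : BorelFixed J) (hr : J.IsRadical) (f : MvPolynomial (MVar v n) K) :
    f ∈ J ↔ ∀ u ∈ f.support, u.support ∉ faces J := by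
  have h : ∀ u : MVar v n →₀ ℕ, u.support ∉ faces J ↔ monomial u (1 : K) ∈ J := fun u => by
    rw [hr.monomial_mem_iff, faces, Set.mem_ofPred_eq, not_not]
  simp only [h]
  refine ⟨fun hf u hu => hB.monomial_mem hf hu, fun hf => ?_⟩
  rw [f.as_sum]
  refine J.sum_mem fun u hu => ?_
  rw [← mul_one (coeff u f), ← C_mul_monomial]
  exact J.mul_mem_left _ (hf u hu)

theorem insert_mem_faces {J : Ideal (MvPolynomial (MVar v n) K)}
    (hB : BorelFixed J) (hr : J.IsRadical) {F : Finset (MVar v n)} (hF : F ∈ faces J)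
    {p q : MVar v n} (hq : q ∈ F) (hpq : q.1 = p.1) (hlt : q.2.1 < p.2.1) :
    insert p F ∈ faces J := by
  by_cases hp : p ∈ F
  · rwa [Finset.insert_eq_of_mem hp]
  obtain ⟨i, j⟩ := p
  obtain ⟨i', k⟩ := q
  obtain rfl : i' = i := hpq
  intro hmem
  let g : ∀ i : Fin v, Matrix (Fin (n i + 1)) (Fin (n i + 1)) K := fun i a b =>
    if a = b then 1 else
      if (⟨i, a⟩ : MVar v n) = ⟨i', k⟩ ∧ (⟨i, b⟩ : MVar v n) = ⟨i', j⟩ then 1 else 0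
  have hgt : ∀ (i : Fin v) (a b : Fin (n i + 1)), b < a → g i a b = 0 := by
    intro i a b hab
    simp only [g]
    rw [if_neg hab.ne', if_neg]
    rintro ⟨h1, h2⟩
    cases h1
    cases h2
    exact absurd hlt (not_lt.2 (le_of_lt hab))
  have hgd : ∀ i, IsUnit (g i).det := by
    intro i
    rw [Matrix.det_of_isUpperTriangular fun a b hab => hgt i a b hab]
    simp [g]
  have hgF : ∀ p ∈ F, gAct g (X p) = X p := by
    intro p hpF
    rw [gAct_X, Finset.sum_eq_single p.2]
    · simp [g]
    · intro a _ ha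
      simp only [g]
      rw [if_neg ha, if_neg, C_0, zero_mul]
      rintro ⟨-, h2⟩
      exact hp (h2 ▸ hpF)
    · simp
  have hgj : gAct g (X ⟨i', j⟩) = X ⟨i', j⟩ + X ⟨i', k⟩ := by
    rw [gAct_X]
    have hkj : k ≠ j := fun h => by subst h; exact lt_irrefl _ hlt
    rw [Finset.sum_eq_add (a := j) (b := k) hkj.symm]
    · simp [g, hkj]
    · rintro a - ⟨h1, h2⟩
      simp only [g]
      rw [if_neg h1, if_neg, C_0, zero_mul]
      rintro ⟨h3, -⟩
      cases h3
      exact h2 rfl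
    · simp
    · simp
  have h1 := hB.gAct_mem hgd hgt hmem
  rw [Finset.prod_insert hp, map_mul, map_prod, Finset.prod_congr rfl hgF, hgj, add_mul] at h1
  rw [Finset.prod_insert hp] at hmem
  have h2 := (J.add_mem_iff_right hmem).1 h1
  refine hF (hr ⟨2, J.mem_of_dvd ?_ h2⟩)
  rw [pow_two]
  exact mul_dvd_mul_right (Finset.dvd_prod_of_mem _ hq) _

/-- The closure of a set of variables under passing to later variables in the same row. -/
def upper (F : Finset (MVar v n)) : Finset (MVar v n) :=
  Finset.univ.filter fun p => ∃ q ∈ F, q.1 = p.1 ∧ q.2.1 ≤ p.2.1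

theorem rk_le_ftype_upper (F : Finset (MVar v n)) : rk F ≤ ftype Sigma.fst (upper F) := by
  refine rk_le_iff.2 fun p hp => ?_
  have h1 : ((Finset.Ici p.2).image fun k => (⟨p.1, k⟩ : MVar v n)).card = n p.1 + 1 - p.2 := by
    rw [Finset.card_image_of_injective _ sigma_mk_injective, Fin.card_Ici]
  rw [← h1]
  refine Finset.card_le_card fun q hq => ?_
  obtain ⟨k, hk, rfl⟩ := Finset.mem_image.1 hq
  simp only [upper, Finset.mem_filter, Finset.mem_univ, true_and, and_true]
  exact ⟨p, hp, rfl, Fin.le_def.1 (Finset.mem_Ici.1 hk)⟩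

theorem upper_mem_faces {J : Ideal (MvPolynomial (MVar v n) K)}
    (hB : BorelFixed J) (hr : J.IsRadical) {F : Finset (MVar v n)} (hF : F ∈ faces J) :
    upper F ∈ faces J := by
  have h : ∀ G : Finset (MVar v n), G ⊆ upper F → G ∪ F ∈ faces J := by
    intro G
    induction G using Finset.induction_on with
    | empty => simpa using hF
    | insert p G hp ih =>
      intro hG
      have hGF := ih ((Finset.subset_insert p G).trans hG)
      obtain ⟨q, hq, h1, h2⟩ := (Finset.mem_filter.1 (hG (Finset.mem_insert_self p G))).2
      rw [Finset.insert_union]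
      rcases h2.lt_or_eq with h2 | h2
      · exact insert_mem_faces hB hr hGF (Finset.mem_union_right _ hq) h1 h2
      · have : q = p := by
          obtain ⟨i, j⟩ := p
          obtain ⟨i', k⟩ := q
          obtain rfl : i' = i := h1
          exact congrArg _ (Fin.ext h2)
        subst this
        rwa [Finset.insert_eq_of_mem (Finset.mem_union_right _ hq)]
  exact isLowerSet_faces J Finset.subset_union_left (h (upper F) subset_rfl)

theorem rk_mem_types_faces {J : Ideal (MvPolynomial (MVar v n) K)}
    (hB : BorelFixed J) (hr : J.IsRadical) {F : Finset (MVar v n)} (hF : F ∈ faces J) :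
    rk F ∈ types (faces J) := ⟨upper F, upper_mem_faces hB hr hF, rk_le_ftype_upper F⟩

/-- The projection killing the variables outside the last `q i` ones in each row `i`. -/
def lastProj (K : Type) [Field K] (q : Fin v → ℕ) :
    MvPolynomial (MVar v n) K →ₐ[K] MvPolynomial (MVar v n) K :=
  aeval fun p => if n p.1 + 1 - p.2 ≤ q p.1 then X p else 0

open Classical in
theorem coeff_lastProj (q : Fin v → ℕ) (f : MvPolynomial (MVar v n) K) (u : MVar v n →₀ ℕ) :
    coeff u (lastProj K q f) = if rk u.support ≤ q then coeff u f else 0 := by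
  induction f using MvPolynomial.induction_on' with
  | add f g hf hg =>
    rw [map_add, coeff_add, coeff_add, hf, hg]
    split_ifs <;> simp
  | monomial w c =>
    have h : lastProj K q (monomial w c) = if rk w.support ≤ q then monomial w c else 0 := by
      rw [lastProj, aeval_monomial, algebraMap_eq]
      split_ifs with hw
      · rw [monomial_eq]
        congr 1
        exact Finset.prod_congr rfl fun p hp =>
          congrArg (· ^ w p) (if_pos (rk_le_iff.1 hw p hp))
      · rw [rk_le_iff] at hw
        push Not at hw
        obtain ⟨p, hp, hlt⟩ := hw
        rw [Finsupp.prod, Finset.prod_eq_zero hp, mul_zero]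
        rw [if_neg (not_le.2 hlt), zero_pow (Finsupp.mem_support_iff.1 hp)]
    rw [h]
    by_cases hwu : w = u
    · subst hwu
      split_ifs <;> simp
    · split_ifs <;> simp [coeff_monomial, hwu]

/-- The intersection of the kernels of the projections `lastProj q`, `q ∈ Q`. -/
def borelIdeal (K : Type) [Field K] (n : Fin v → ℕ) (Q : Set (Fin v → ℕ)) :
    Ideal (MvPolynomial (MVar v n) K) :=
  ⨅ q ∈ Q, RingHom.ker (lastProj (n := n) K q)

theorem mem_borelIdeal {Q : Set (Fin v → ℕ)} {f : MvPolynomial (MVar v n) K} :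
    f ∈ borelIdeal K n Q ↔ ∀ q ∈ Q, lastProj K q f = 0 := by
  simp [borelIdeal, RingHom.mem_ker]

theorem mem_borelIdeal_iff_support {Q : Set (Fin v → ℕ)} (hQ : IsLowerSet Q)
    (f : MvPolynomial (MVar v n) K) :
    f ∈ borelIdeal K n Q ↔ ∀ u ∈ f.support, rk u.support ∉ Q := by
  rw [mem_borelIdeal]
  constructor
  · intro h u hu hq
    have := congrArg (coeff u) (h _ hq)
    rw [coeff_lastProj, if_pos le_rfl, coeff_zero] at this
    exact mem_support_iff.1 hu this
  · intro h q hq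
    ext u
    rw [coeff_lastProj, coeff_zero]
    split_ifs with hle
    · by_contra hne
      exact h u (mem_support_iff.2 hne) (hQ hle hq)
    · rfl

theorem isRadical_borelIdeal (Q : Set (Fin v → ℕ)) : (borelIdeal K n Q).IsRadical := by
  rintro f ⟨m, hm⟩
  rw [mem_borelIdeal] at hm ⊢
  intro q hq
  have := hm q hq
  rw [map_pow] at this
  exact eq_zero_of_pow_eq_zero this

theorem gAct_mem_borelIdeal {Q : Set (Fin v → ℕ)}
    {g : ∀ i : Fin v, Matrix (Fin (n i + 1)) (Fin (n i + 1)) K}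
    (hg : ∀ (i : Fin v) (k j : Fin (n i + 1)), j < k → g i k j = 0)
    {f : MvPolynomial (MVar v n) K} (hf : f ∈ borelIdeal K n Q) :
    gAct g f ∈ borelIdeal K n Q := by
  rw [mem_borelIdeal] at hf ⊢
  intro q hq
  have h : (lastProj K q).comp (gAct g) =
      (lastProj K q).comp ((gAct g).comp (lastProj K q)) := by
    refine MvPolynomial.algHom_ext fun p => ?_
    simp only [AlgHom.comp_apply]
    by_cases hp : n p.1 + 1 - p.2 ≤ q p.1
    · rw [lastProj, aeval_X, if_pos hp]
    · rw [show lastProj K q (X p) = 0 by rw [lastProj, aeval_X, if_neg hp], map_zero, map_zero,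
        gAct_X, map_sum]
      refine Finset.sum_eq_zero fun k _ => ?_
      by_cases hk : p.2 < k
      · rw [hg _ _ _ hk, C_0, zero_mul, map_zero]
      · rw [map_mul, lastProj, aeval_X, if_neg, mul_zero]
        have := Fin.le_def.1 (not_lt.1 hk)
        simp only
        omega
  have h' := congrArg (fun φ => φ f) h
  simp only [AlgHom.comp_apply, hf q hq, map_zero] at h'
  exact h'

theorem borelFixed_borelIdeal (Q : Set (Fin v → ℕ)) : BorelFixed (borelIdeal K n Q) := by
  intro g hd hg
  refine le_antisymm (Ideal.map_le_iff_le_comap.2 fun f hf => gAct_mem_borelIdeal hg hf)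
    fun f hf => ?_
  have hinv : ∀ (i : Fin v) (k j : Fin (n i + 1)), j < k → (g i)⁻¹ k j = 0 := by
    intro i
    have := Matrix.invertibleOfIsUnitDet (g i) (hd i)
    have h := Matrix.blockTriangular_inv_of_blockTriangular (M := g i) (b := id)
      (fun a b hab => hg i a b hab)
    exact fun k j hjk => h hjk
  have h1 : gAct g (gAct (fun i => (g i)⁻¹) f) = f := by
    rw [← AlgHom.comp_apply, gAct_mul]
    have : (fun i => g i * (g i)⁻¹) = fun i => 1 :=
      funext fun i => Matrix.mul_nonsing_inv _ (hd i)
    rw [this, gAct_one, AlgHom.id_apply]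
  rw [← h1]
  exact Ideal.mem_map_of_mem _ (gAct_mem_borelIdeal hinv hf)

end Borel

section Initial
variable {σ ι K α : Type} [DecidableEq ι] [Field K] [LinearOrder α] (ρ : σ → ι)
  (key : (σ →₀ ℕ) → α)

/-- The exponents of the leading monomials of homogeneous elements of `I`. -/
def inSet (I : Ideal (MvPolynomial σ K)) : Set (σ →₀ ℕ) :=
  {u | u ∈ leadSet key (ghSub ρ I (mdeg ρ u))}

variable {key}

theorem leadSet_ghSub (I : Ideal (MvPolynomial σ K)) (a : ι → ℕ) :
    leadSet key (ghSub ρ I a) = {u | mdeg ρ u = a ∧ u ∈ inSet ρ key I} := by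
  ext u
  constructor
  · intro h
    obtain ⟨f, hf, hu, -⟩ := id h
    obtain rfl := mdeg_eq_of_mem_support ρ hf.2 hu
    exact ⟨rfl, h⟩
  · rintro ⟨rfl, h⟩
    exact h

theorem gh_eq_ncard_inSet [Finite σ] (hkey : Function.Injective key)
    (I : Ideal (MvPolynomial σ K)) (a : ι → ℕ) :
    gh ρ I a = {u | mdeg ρ u = a ∧ u ∈ inSet ρ key I}.ncard := by
  rw [gh_eq_ncard_leadSet ρ hkey, leadSet_ghSub]

theorem mem_inSet_of_mem {I : Ideal (MvPolynomial σ K)} {f : MvPolynomial σ K} {a : ι → ℕ}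
    (hf : f ∈ ghSub ρ I a) {u : σ →₀ ℕ} (hu : u ∈ f.support)
    (h : ∀ w ∈ f.support, key w ≤ key u) : u ∈ inSet ρ key I := by
  have : u ∈ leadSet key (ghSub ρ I a) := ⟨f, hf, hu, h⟩
  rw [leadSet_ghSub] at this
  exact this.2

variable (hmono : ∀ u w t, key u ≤ key w → key (u + t) ≤ key (w + t))
include hmono

theorem isUpperSet_inSet (I : Ideal (MvPolynomial σ K)) : IsUpperSet (inSet ρ key I) := by
  rintro u w huw ⟨f, hf, hu, hlead⟩
  obtain ⟨t, rfl⟩ := le_iff_exists_add.1 huw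
  refine mem_inSet_of_mem ρ (f := f * monomial t 1) (a := mdeg ρ u + mdeg ρ t)
    ⟨I.mul_mem_right _ hf.1, hf.2.mul (isWeightedHomogeneous_monomial _ _ _ rfl)⟩ ?_ ?_
  · rw [mem_support_iff, coeff_mul_monomial, mul_one]
    exact mem_support_iff.1 hu
  · intro w hw
    rw [mem_support_iff, coeff_mul_monomial'] at hw
    split_ifs at hw with hle
    · rw [mul_one, ← mem_support_iff] at hw
      have := hmono _ _ t (hlead _ hw)
      rwa [tsub_add_cancel_of_le hle] at this
    · exact (hw rfl).elim

theorem mem_inSet_colon_iff (hkey : Function.Injective key) (x : σ)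
    (hx : ∀ u w, key u ≤ key w → w x ≤ u x) (I : Ideal (MvPolynomial σ K)) (u : σ →₀ ℕ) :
    u ∈ inSet ρ key (I.colon (Ideal.span {(X x : MvPolynomial σ K)})) ↔
      u + Finsupp.single x 1 ∈ inSet ρ key I := by
  classical
  constructor
  · rintro ⟨f, hf, hu, hlead⟩
    refine mem_inSet_of_mem ρ (f := f * X x) (a := mdeg ρ u + rowWt ρ x)
      ⟨Ideal.mem_colon_span_singleton.1 hf.1, hf.2.mul (isWeightedHomogeneous_X _ _ _)⟩ ?_ ?_
    · rw [mem_support_iff, coeff_mul_X]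
      exact mem_support_iff.1 hu
    · intro w hw
      rw [mem_support_iff, coeff_mul_X'] at hw
      split_ifs at hw with hxw
      · have := hmono _ _ (Finsupp.single x 1) (hlead _ (mem_support_iff.2 hw))
        rwa [tsub_add_cancel_of_le (Finsupp.single_le_iff.2
          (Nat.one_le_iff_ne_zero.2 (Finsupp.mem_support_iff.1 hxw)))] at this
      · exact (hw rfl).elim
  · rintro ⟨f, hf, hu, hlead⟩
    have hge : ∀ w ∈ f.support, w x ≠ 0 := by
      intro w hw
      have := hx _ _ (hlead w hw)
      simp only [Finsupp.add_apply, Finsupp.single_eq_same] at this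
      omega
    set g := f.divMonomial (Finsupp.single x 1)
    have hg : ∀ w, coeff w g = coeff (w + Finsupp.single x 1) f := fun w => by
      rw [coeff_divMonomial, add_comm]
    have hfg : g * X x = f := by
      ext w
      rw [coeff_mul_X']
      split_ifs with hw
      · rw [hg, tsub_add_cancel_of_le (Finsupp.single_le_iff.2
          (Nat.one_le_iff_ne_zero.2 (Finsupp.mem_support_iff.1 hw)))]
      · by_contra hne
        exact hge w (mem_support_iff.2 (Ne.symm hne)) (Finsupp.notMem_support_iff.1 hw)
    refine mem_inSet_of_mem ρ (f := g) (a := mdeg ρ u) ⟨?_, ?_⟩ ?_ ?_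
    · refine Ideal.mem_colon_span_singleton.2 ?_
      rw [hfg]
      exact hf.1
    · intro w hw
      rw [hg] at hw
      have := hf.2 hw
      change mdeg ρ (w + _) = mdeg ρ (u + _) at this
      rw [mdeg_add, mdeg_add] at this
      exact add_right_cancel this
    · rw [mem_support_iff, hg]
      exact mem_support_iff.1 hu
    · intro w hw
      rw [mem_support_iff, hg] at hw
      have h1 := hlead _ (mem_support_iff.2 hw)
      by_contra hlt
      have h2 := hmono _ _ (Finsupp.single x 1) (not_le.1 hlt).le
      have h3 := add_right_cancel (hkey (le_antisymm h1 h2))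
      exact hlt (h3 ▸ le_rfl)

end Initial

section Graded
variable {σ σ' ι K : Type} [DecidableEq ι] {ρ : σ → ι} {ρ' : σ' → ι} [Field K]

/-- An algebra homomorphism between polynomial rings is graded as soon as it maps variables to
homogeneous elements of the right degree. -/
theorem isWeightedHomogeneous_algHom
    (φ : MvPolynomial σ K →ₐ[K] MvPolynomial σ' K)
    (hφ : ∀ p, (φ (X p)).IsWeightedHomogeneous (rowWt ρ') (rowWt ρ p))
    {f : MvPolynomial σ K} {a : ι → ℕ} (hf : f.IsWeightedHomogeneous (rowWt ρ) a) :
    (φ f).IsWeightedHomogeneous (rowWt ρ') a := by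
  rw [f.as_sum, map_sum]
  refine IsWeightedHomogeneous.sum _ _ _ fun u hu => ?_
  rw [monomial_eq, map_mul, algHom_C, Finsupp.prod, map_prod, algebraMap_eq]
  have h : a = 0 + ∑ p ∈ u.support, u p • rowWt ρ p := by
    rw [zero_add, ← mdeg_eq_of_mem_support ρ hf hu, mdeg, Finsupp.weight_apply, Finsupp.sum]
  rw [h]
  refine (isWeightedHomogeneous_C _ _).mul (IsWeightedHomogeneous.prod _ _ _ fun p _ => ?_)
  rw [map_pow]
  exact (hφ p).pow _

theorem weightedHomogeneousComponent_mul_of_right {f g : MvPolynomial σ K} {a d : ι → ℕ}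
    (hg : g.IsWeightedHomogeneous (rowWt ρ) d) :
    weightedHomogeneousComponent (rowWt ρ) (a + d) (f * g) =
      weightedHomogeneousComponent (rowWt ρ) a f * g := by
  classical
  let _ := weightedGradedAlgebra K (rowWt ρ)
  have h := DirectSum.coe_decompose_mul_add_of_right_mem
    (weightedHomogeneousSubmodule K (rowWt ρ)) (a := f) (i := a) hg
  change ((weightedDecomposition K (rowWt ρ)).decompose' (f * g) (a + d) : MvPolynomial σ K) =
    ((weightedDecomposition K (rowWt ρ)).decompose' f a : MvPolynomial σ K) * g at h
  rwa [weightedDecomposition.decompose'_apply, weightedDecomposition.decompose'_apply] at h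

end Graded

section Coordinates
variable {K : Type} [Field K] {v : ℕ} {n : Fin v → ℕ}

theorem eq_single_of_mdeg_eq {σ ι : Type} [DecidableEq ι] {ρ : σ → ι} {u : σ →₀ ℕ} {i : ι}
    (h : mdeg ρ u = Pi.single i 1) : ∃ p, ρ p = i ∧ u = Finsupp.single p 1 := by
  have hne : u ≠ 0 := by
    rintro rfl
    have := congrFun h i
    simp [mdeg_zero] at this
  obtain ⟨p, hp⟩ := Finsupp.support_nonempty_iff.2 hne
  have hle : Finsupp.single p 1 ≤ u :=
    Finsupp.single_le_iff.2 (Nat.one_le_iff_ne_zero.2 (Finsupp.mem_support_iff.1 hp))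
  obtain ⟨t, rfl⟩ := le_iff_exists_add.1 hle
  rw [mdeg_add, mdeg_single] at h
  have hpi : ρ p = i := by
    by_contra hpi
    have := congrFun h (ρ p)
    simp [Pi.single_eq_of_ne hpi] at this
  refine ⟨p, hpi, ?_⟩
  subst hpi
  have ht : mdeg ρ t = 0 := by
    simpa using h
  have : t = 0 := by
    ext q
    have := le_mdeg ρ t q
    rw [ht] at this
    simpa using this
  rw [this, add_zero]

theorem isWeightedHomogeneous_gAct (g : ∀ i : Fin v, Matrix (Fin (n i + 1)) (Fin (n i + 1)) K)
    {f : MvPolynomial (MVar v n) K} {a : Fin v → ℕ}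
    (hf : f.IsWeightedHomogeneous (wt v n) a) : (gAct g f).IsWeightedHomogeneous (wt v n) a := by
  refine isWeightedHomogeneous_algHom (gAct g) (fun p => ?_) hf
  rw [gAct_X]
  refine IsWeightedHomogeneous.sum _ _ _ fun k _ => ?_
  exact (isWeightedHomogeneous_X K (wt v n) (⟨p.1, k⟩ : MVar v n)).C_mul _

theorem exists_gAct_X_eq {L : MvPolynomial (MVar v n) K} (hL0 : L ≠ 0) {i : Fin v}
    (hL : L.IsWeightedHomogeneous (wt v n) (Pi.single i 1)) :
    ∃ (g : ∀ i : Fin v, Matrix (Fin (n i + 1)) (Fin (n i + 1)) K) (x : MVar v n),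
      (∀ i, IsUnit (g i).det) ∧ x.1 = i ∧ gAct g (X x) = L := by
  classical
  obtain ⟨u, hu⟩ := support_nonempty.2 hL0
  obtain ⟨⟨i, j₀⟩, rfl, rfl⟩ := eq_single_of_mdeg_eq (mdeg_eq_of_mem_support Sigma.fst hL hu)
  have hx := mem_support_iff.1 hu
  let G : Matrix (Fin (n i + 1)) (Fin (n i + 1)) K :=
    (1 : Matrix (Fin (n i + 1)) (Fin (n i + 1)) K).updateCol j₀
      fun a => coeff (Finsupp.single (⟨i, a⟩ : MVar v n) 1) L
  have hG : IsUnit G.det := by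
    rw [← Matrix.cramer_apply, Matrix.cramer_one]
    exact isUnit_iff_ne_zero.2 hx
  have hGL : ∀ a, G a j₀ = coeff (Finsupp.single (⟨i, a⟩ : MVar v n) 1) L := fun a =>
    Matrix.updateCol_self
  refine ⟨Function.update (fun _ => 1) i G, ⟨i, j₀⟩, fun k => ?_, rfl, ?_⟩
  · by_cases hk : k = i
    · subst hk
      rwa [Function.update_self]
    · rw [Function.update_of_ne hk, Matrix.det_one]
      exact isUnit_one
  · rw [gAct_X]
    simp only [Function.update_self, hGL]
    clear_value G
    ext u
    rw [coeff_sum]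
    by_cases hu : u ∈ L.support
    · obtain ⟨⟨k, j⟩, hk, rfl⟩ := eq_single_of_mdeg_eq (mdeg_eq_of_mem_support Sigma.fst hL hu)
      obtain rfl : k = i := hk
      rw [Finset.sum_eq_single j]
      · rw [coeff_C_mul, coeff_X, if_pos rfl, mul_one]
      · intro l _ hl
        rw [coeff_C_mul, coeff_X, if_neg, mul_zero]
        intro h
        have := Finsupp.single_left_injective one_ne_zero h
        exact hl (by simpa using this)
      · exact fun h => (h (Finset.mem_univ _)).elim
    · rw [notMem_support_iff.1 hu]
      refine Finset.sum_eq_zero fun k _ => ?_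
      rw [coeff_C_mul, coeff_X]
      split_ifs with h
      · rw [h, notMem_support_iff.1 hu, zero_mul]
      · rw [mul_zero]

/-- A nonzero linear form is a variable after a graded change of coordinates. -/
theorem exists_algEquiv_X {L : MvPolynomial (MVar v n) K} (hL0 : L ≠ 0) {i : Fin v}
    (hL : L.IsWeightedHomogeneous (wt v n) (Pi.single i 1)) :
    ∃ (e : MvPolynomial (MVar v n) K ≃ₐ[K] MvPolynomial (MVar v n) K) (x : MVar v n),
      x.1 = i ∧ e (X x) = L ∧
      (∀ f a, f.IsWeightedHomogeneous (wt v n) a → (e f).IsWeightedHomogeneous (wt v n) a) ∧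
      ∀ f a, f.IsWeightedHomogeneous (wt v n) a → (e.symm f).IsWeightedHomogeneous (wt v n) a := by
  obtain ⟨g, x, hg, hx, hgx⟩ := exists_gAct_X_eq hL0 hL
  have h1 : (gAct g).comp (gAct fun i => (g i)⁻¹) = AlgHom.id K _ := by
    rw [gAct_mul, funext fun i => Matrix.mul_nonsing_inv _ (hg i)]
    exact gAct_one
  have h2 : (gAct fun i => (g i)⁻¹).comp (gAct g) = AlgHom.id K _ := by
    rw [gAct_mul, funext fun i => Matrix.nonsing_inv_mul _ (hg i)]
    exact gAct_one
  refine ⟨AlgEquiv.ofAlgHom (gAct g) (gAct fun i => (g i)⁻¹) h1 h2, x, hx, ?_, ?_, ?_⟩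
  · rw [AlgEquiv.ofAlgHom_apply]
    exact hgx
  · intro f a hf
    rw [AlgEquiv.ofAlgHom_apply]
    exact isWeightedHomogeneous_gAct _ hf
  · intro f a hf
    rw [AlgEquiv.ofAlgHom_symm, AlgEquiv.ofAlgHom_apply]
    exact isWeightedHomogeneous_gAct _ hf

theorem gh_colon_eq_of_algEquiv {σ ι : Type} [DecidableEq ι] (ρ : σ → ι)
    (e : MvPolynomial σ K ≃ₐ[K] MvPolynomial σ K)
    (he : ∀ f a, f.IsWeightedHomogeneous (rowWt ρ) a → (e f).IsWeightedHomogeneous (rowWt ρ) a)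
    (he' : ∀ f a, f.IsWeightedHomogeneous (rowWt ρ) a →
      (e.symm f).IsWeightedHomogeneous (rowWt ρ) a)
    (I : Ideal (MvPolynomial σ K)) (f : MvPolynomial σ K) (a : ι → ℕ) :
    gh ρ ((I.comap e).colon (Ideal.span {f})) a = gh ρ (I.colon (Ideal.span {e f})) a := by
  rw [← gh_comap_algEquiv ρ e he he' (I.colon _)]
  congr 1
  ext g
  rw [Ideal.mem_colon_span_singleton, Ideal.mem_comap, Ideal.mem_comap,
    Ideal.mem_colon_span_singleton, map_mul]

end Coordinates

section Colon
variable {K : Type} [Field K] {v : ℕ} {n : Fin v → ℕ}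

theorem isMultigraded_colon {I : Ideal (MvPolynomial (MVar v n) K)} (hI : IsMultigraded I)
    {L : MvPolynomial (MVar v n) K} {d : Fin v → ℕ} (hL : L.IsWeightedHomogeneous (wt v n) d) :
    IsMultigraded (I.colon (Ideal.span {L})) := by
  intro f hf a
  rw [Ideal.mem_colon_span_singleton] at hf ⊢
  exact (weightedHomogeneousComponent_mul_of_right (ρ := Sigma.fst) hL) ▸ hI _ hf (a + d)

theorem ncard_and_add_ncard_and_not {σ ι : Type} [Finite σ] [DecidableEq ι] (ρ : σ → ι)
    (a : ι → ℕ) (P : (σ →₀ ℕ) → Prop) :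
    {u | mdeg ρ u = a ∧ P u}.ncard + {u | mdeg ρ u = a ∧ ¬ P u}.ncard =
      {u : σ →₀ ℕ | mdeg ρ u = a}.ncard := by
  rw [← Set.ncard_union_eq ?_ (finite_of_mdeg ρ a fun u hu => hu.1)
    (finite_of_mdeg ρ a fun u hu => hu.1)]
  · congr 1
    ext u
    by_cases h : P u <;> simp [h]
  · rw [Set.disjoint_left]
    exact fun u h h' => h'.2 h.2

theorem gh_colon_X_eq_gh_borelIdeal [Infinite K] {I J : Ideal (MvPolynomial (MVar v n) K)}
    (hr : J.IsRadical) (hB : BorelFixed J) (hIJ : ∀ a, gh Sigma.fst I a = gh Sigma.fst J a)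
    (x : MVar v n) : ∃ Q, ∀ a,
      gh Sigma.fst (I.colon (Ideal.span {(X x : MvPolynomial (MVar v n) K)})) a =
        gh Sigma.fst (borelIdeal K n Q) a := by
  classical
  let θ : (MVar v n →₀ ℕ) →+ ℤ :=
    -((Nat.castAddMonoidHom ℤ).comp (Finsupp.applyAddHom x))
  obtain ⟨key, hkey, hmono, -, hθ⟩ := exists_key θ
  have hx : ∀ u w, key u ≤ key w → w x ≤ u x := fun u w h => by
    have := hθ u w h
    simp only [θ, AddMonoidHom.neg_apply, AddMonoidHom.comp_apply, Finsupp.applyAddHom_apply,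
      Nat.coe_castAddMonoidHom] at this
    omega
  set E := inSet Sigma.fst key I
  have hE : IsUpperSet E := isUpperSet_inSet Sigma.fst hmono I
  have hstd : ∀ a, {u : MVar v n →₀ ℕ | mdeg Sigma.fst u = a ∧ u.support ∈ faces J}.ncard =
      {u | mdeg Sigma.fst u = a ∧ u ∉ E}.ncard := by
    intro a
    have h1 := gh_eq_ncard_inSet Sigma.fst hkey I a
    have h2 := gh_eq_ncard_of_mem_iff Sigma.fst J {u | u.support ∉ faces J}
      (mem_iff_support_notMem_faces hB hr) a
    have h3 := ncard_and_add_ncard_and_not Sigma.fst a (· ∈ E)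
    have h4 := ncard_and_add_ncard_and_not Sigma.fst a
      fun u : MVar v n →₀ ℕ => u.support ∈ faces J
    have h5 := h1.symm.trans ((hIJ a).trans h2)
    exact Nat.add_right_cancel ((h4.trans h3.symm).trans
      ((congrArg (· + _) h5).trans (add_comm _ _)))
  set Δ : Set (Finset (MVar v n)) := {F | ∀ w : MVar v n →₀ ℕ, w.support ⊆ F → w ∉ E}
  have hΔ : IsLowerSet Δ := fun F G h hF w hw => hF w (hw.trans h)
  have htypes : types (faces J) ⊆ types Δ := by
    rintro q ⟨F, hF, hq⟩
    obtain ⟨G, hG, hle⟩ := exists_ftype_le Sigma.fst _ E hE hstd hF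
    exact ⟨G, hG, hq.trans hle⟩
  have hfin : ∀ (a : Fin v → ℕ) (P : (MVar v n →₀ ℕ) → Prop),
      {u | mdeg Sigma.fst u = a ∧ P u}.Finite :=
    fun a P => finite_of_mdeg Sigma.fst a fun u hu => hu.1
  have hle₁ : ∀ a, {u : MVar v n →₀ ℕ | mdeg Sigma.fst u = a ∧ u.support ∈ faces J}.ncard ≤
      {u : MVar v n →₀ ℕ | mdeg Sigma.fst u = a ∧ rk u.support ∈ types Δ}.ncard := fun a =>
    Set.ncard_le_ncard (fun u hu => ⟨hu.1, htypes (rk_mem_types_faces hB hr hu.2)⟩) (hfin _ _)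
  have hsub : ∀ a, {u : MVar v n →₀ ℕ | mdeg Sigma.fst u = a ∧ u.support ∈ Δ} ⊆
      {u | mdeg Sigma.fst u = a ∧ u ∉ E} := fun a u hu => ⟨hu.1, hu.2 u subset_rfl⟩
  have hstdΔ : ∀ a, {u : MVar v n →₀ ℕ | mdeg Sigma.fst u = a ∧ u.support ∈ Δ} =
      {u | mdeg Sigma.fst u = a ∧ u ∉ E} := fun a =>
    Set.eq_of_subset_of_ncard_le (hsub a) (by
      rw [← hstd]
      exact (hle₁ a).trans (ncard_types_le hΔ a)) (hfin _ _)
  have hmem : ∀ u, u ∈ E ↔ u.support ∉ Δ := by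
    intro u
    have := Set.ext_iff.1 (hstdΔ (mdeg Sigma.fst u)) u
    simp only [Set.mem_ofPred_eq, true_and] at this
    rw [this, not_not]
  have hΔeq : ∀ a, {u : MVar v n →₀ ℕ | mdeg Sigma.fst u = a ∧ u.support ∈ Δ}.ncard ≤
      {u : MVar v n →₀ ℕ | mdeg Sigma.fst u = a ∧ rk u.support ∈ types Δ}.ncard := fun a => by
    rw [hstdΔ, ← hstd]
    exact hle₁ a
  refine ⟨types (star Δ x), fun b => ?_⟩
  have hstar : IsLowerSet (star Δ x) := fun F G h (hF : insert x F ∈ Δ) =>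
    show insert x G ∈ Δ from hΔ (Finset.insert_subset_insert x h) hF
  have hdel : IsLowerSet (del Δ x) := fun F G h hF => ⟨hΔ h hF.1, fun hx => hF.2 (h hx)⟩
  have e1 := hΔeq (b + Pi.single x.1 1)
  have e2 := ncard_types_le_star_add_del hΔ x (b + Pi.single x.1 1)
  have e3 := ncard_star_add_del_le Δ x (b + Pi.single x.1 1)
  have e4 := ncard_types_le hstar b
  have e5 := ncard_types_le hdel (b + Pi.single x.1 1)
  simp only [add_left_inj] at e2 e3
  have h1 := gh_eq_ncard_inSet Sigma.fst hkey
    (I.colon (Ideal.span {(X x : MvPolynomial (MVar v n) K)})) b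
  simp only [mem_inSet_colon_iff Sigma.fst hmono hkey x hx I] at h1
  have h2 := gh_eq_ncard_of_mem_iff Sigma.fst (borelIdeal K n (types (star Δ x)))
    {u | rk u.support ∉ types (star Δ x)} (mem_borelIdeal_iff_support (isLowerSet_types _)) b
  have h3 := ncard_and_add_ncard_and_not Sigma.fst b
    fun u : MVar v n →₀ ℕ => u.support ∈ star Δ x
  have h4 := ncard_and_add_ncard_and_not Sigma.fst b
    fun u : MVar v n →₀ ℕ => rk u.support ∈ types (star Δ x)
  have h5 : {u | mdeg Sigma.fst u = b ∧ u + Finsupp.single x 1 ∈ E} =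
      {u | mdeg Sigma.fst u = b ∧ ¬ u.support ∈ star Δ x} := by
    ext u
    have : (u + Finsupp.single x 1).support = insert x u.support := by
      ext p
      by_cases h : x = p
      · simp [h]
      · simp [Ne.symm h]
    simp only [Set.mem_ofPred_eq, hmem, this, star]
  rw [h5] at h1
  have h6 : {u : MVar v n →₀ ℕ | mdeg Sigma.fst u = b ∧ u.support ∈ star Δ x}.ncard =
      {u : MVar v n →₀ ℕ | mdeg Sigma.fst u = b ∧ rk u.support ∈ types (star Δ x)}.ncard := by
    omega
  rw [h1, h2]
  have h7 := h3.trans h4.symm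
  exact Nat.add_left_cancel (h7.trans (congrArg (· + _) h6.symm))

theorem isCS_colon [Infinite K] {I : Ideal (MvPolynomial (MVar v n) K)} (hI : IsCS I)
    {L : MvPolynomial (MVar v n) K} (hL0 : L ≠ 0) {i : Fin v}
    (hL : L.IsWeightedHomogeneous (wt v n) (Pi.single i 1)) :
    IsCS (I.colon (Ideal.span {L})) := by
  obtain ⟨hm, J, hr, hB, hJ⟩ := hI
  obtain ⟨e, x, -, rfl, he, he'⟩ := exists_algEquiv_X hL0 hL
  obtain ⟨Q, hQ⟩ := gh_colon_X_eq_gh_borelIdeal (I := I.comap e) hr hB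
    (fun a => (gh_comap_algEquiv Sigma.fst e he he' I a).trans (hJ a)) x
  refine ⟨isMultigraded_colon hm hL, borelIdeal K n Q, isRadical_borelIdeal Q,
    borelFixed_borelIdeal Q, fun a => ?_⟩
  rw [hilb_eq_gh, hilb_eq_gh, ← hQ, gh_colon_eq_of_algEquiv Sigma.fst e he he']

end Colon

section Shear
variable {σ ι K : Type} [DecidableEq σ] [DecidableEq ι] [Field K] {ρ : σ → ι} {p₀ : ι → σ}

/-- The coordinate change scaling the variables `x_{p₀ i}` by `c` and translating all other
variables `x_p` by `d p • x_{p₀ (ρ p)}`. -/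
def shear (ρ : σ → ι) (p₀ : ι → σ) (c d : σ → K) : MvPolynomial σ K →ₐ[K] MvPolynomial σ K :=
  aeval fun p => if p = p₀ (ρ p) then C (c p) * X p else X p + C (d p) * X (p₀ (ρ p))

theorem shear_X_p₀ (hp : ∀ i, ρ (p₀ i) = i) (c d : σ → K) (i : ι) :
    shear ρ p₀ c d (X (p₀ i)) = C (c (p₀ i)) * X (p₀ i) := by
  rw [shear, aeval_X, hp, if_pos rfl]

theorem shear_X_of_ne (c d : σ → K) {p : σ} (h : p ≠ p₀ (ρ p)) :
    shear ρ p₀ c d (X p) = X p + C (d p) * X (p₀ (ρ p)) := by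
  rw [shear, aeval_X, if_neg h]

theorem shear_comp_shear (hp : ∀ i, ρ (p₀ i) = i) {c d c' d' : σ → K}
    (hc : ∀ i, c (p₀ i) * c' (p₀ i) = 1) (hd : ∀ p, d p + c (p₀ (ρ p)) * d' p = 0) :
    (shear ρ p₀ c d).comp (shear ρ p₀ c' d') = AlgHom.id K _ := by
  refine MvPolynomial.algHom_ext fun p => ?_
  rw [AlgHom.comp_apply, AlgHom.id_apply]
  by_cases h : p = p₀ (ρ p)
  · rw [h, shear_X_p₀ hp, map_mul, algHom_C, shear_X_p₀ hp, algebraMap_eq, ← mul_assoc, ← C_mul,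
      mul_comm, mul_comm (c' _), hc, C_1, mul_one]
  · rw [shear_X_of_ne _ _ h, map_add, map_mul, algHom_C, shear_X_of_ne _ _ h, shear_X_p₀ hp,
      algebraMap_eq, add_assoc, ← mul_assoc, ← C_mul, ← add_mul, ← C_add, mul_comm (d' p), hd,
      C_0, zero_mul, add_zero]

theorem isWeightedHomogeneous_shear (hp : ∀ i, ρ (p₀ i) = i) (c d : σ → K)
    {f : MvPolynomial σ K} {a : ι → ℕ} (hf : f.IsWeightedHomogeneous (rowWt ρ) a) :
    (shear ρ p₀ c d f).IsWeightedHomogeneous (rowWt ρ) a := by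
  refine isWeightedHomogeneous_algHom _ (fun p => ?_) hf
  by_cases h : p = p₀ (ρ p)
  · rw [shear, aeval_X, if_pos h]
    exact (isWeightedHomogeneous_X K (rowWt ρ) p).C_mul _
  · rw [shear_X_of_ne _ _ h]
    refine (isWeightedHomogeneous_X K (rowWt ρ) p).add ?_
    have := (isWeightedHomogeneous_X K (rowWt ρ) (p₀ (ρ p))).C_mul (d p)
    rwa [rowWt, hp] at this

theorem exists_algEquiv_shear (hp : ∀ i, ρ (p₀ i) = i) {c : σ → K} (hc : ∀ i, c (p₀ i) ≠ 0) :
    ∃ e : MvPolynomial σ K ≃ₐ[K] MvPolynomial σ K, (∀ f, e f = shear ρ p₀ c c f) ∧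
      (∀ f a, f.IsWeightedHomogeneous (rowWt ρ) a → (e f).IsWeightedHomogeneous (rowWt ρ) a) ∧
      ∀ f a, f.IsWeightedHomogeneous (rowWt ρ) a →
        (e.symm f).IsWeightedHomogeneous (rowWt ρ) a := by
  have h1 : (shear ρ p₀ c c).comp
      (shear ρ p₀ (fun p => (c p)⁻¹) fun p => -(c (p₀ (ρ p)))⁻¹ * c p) = AlgHom.id K _ :=
    shear_comp_shear hp (fun i => mul_inv_cancel₀ (hc i)) fun p => by
      rw [neg_mul, mul_neg, mul_inv_cancel_left₀ (hc _), add_neg_cancel]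
  have h2 : (shear ρ p₀ (fun p => (c p)⁻¹) fun p => -(c (p₀ (ρ p)))⁻¹ * c p).comp
      (shear ρ p₀ c c) = AlgHom.id K _ :=
    shear_comp_shear hp (fun i => inv_mul_cancel₀ (hc i)) fun p => by
      rw [neg_mul, neg_add_cancel]
  refine ⟨AlgEquiv.ofAlgHom _ _ h1 h2, fun f => rfl, fun f a hf => ?_, fun f a hf => ?_⟩
  · rw [AlgEquiv.ofAlgHom_apply]
    exact isWeightedHomogeneous_shear hp _ _ hf
  · rw [AlgEquiv.ofAlgHom_symm, AlgEquiv.ofAlgHom_apply]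
    exact isWeightedHomogeneous_shear hp _ _ hf

theorem eval_shear (hp : ∀ i, ρ (p₀ i) = i) (c : σ → K) (f : MvPolynomial σ K) :
    eval (fun p => if p = p₀ (ρ p) then 1 else 0) (shear ρ p₀ c c f) = eval c f := by
  have : (aeval fun p => if p = p₀ (ρ p) then (1 : K) else 0).comp (shear ρ p₀ c c) = aeval c := by
    refine MvPolynomial.algHom_ext fun p => ?_
    rw [AlgHom.comp_apply]
    by_cases h : p = p₀ (ρ p)
    · rw [shear, aeval_X, if_pos h, map_mul, aeval_C, aeval_X, aeval_X, if_pos h, mul_one]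
      rfl
    · rw [shear_X_of_ne _ _ h, map_add, map_mul, aeval_C, aeval_X, aeval_X, aeval_X, if_neg h, hp,
        if_pos rfl, mul_one, zero_add]
      rfl
  exact DFunLike.congr_fun this f

end Shear

section Star
variable {σ ι K : Type} [DecidableEq ι] [Field K] (ρ : σ → ι) (p₀ : ι → σ)

/-- The degrees in which the ideal `I` has nonzero elements. -/
def degSet (I : Ideal (MvPolynomial σ K)) : Set (ι → ℕ) := {b | ∃ f ∈ ghSub ρ I b, f ≠ 0}

/-- The exponents of degree `a` whose restriction to the variables `x_{p₀ i}` lies in `U`. -/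
def cylSet (U : Set (ι → ℕ)) (a : ι → ℕ) : Set (σ →₀ ℕ) :=
  {u | mdeg ρ u = a ∧ (fun i => u (p₀ i)) ∈ U}

theorem finite_cylSet [Finite σ] (U : Set (ι → ℕ)) (a : ι → ℕ) : (cylSet ρ p₀ U a).Finite :=
  finite_of_mdeg ρ a fun _ hu => hu.1

variable {ρ p₀}

theorem mem_degSet_iff_gh_ne_zero [Finite σ] {I : Ideal (MvPolynomial σ K)} {b : ι → ℕ} :
    b ∈ degSet ρ I ↔ gh ρ I b ≠ 0 := by
  rw [gh, Ne, Submodule.finrank_eq_zero, Submodule.eq_bot_iff]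
  push Not
  rfl

theorem isUpperSet_degSet (hp : ∀ i, ρ (p₀ i) = i) [Finite ι] (I : Ideal (MvPolynomial σ K)) :
    IsUpperSet (degSet ρ I) := by
  classical
  have := Fintype.ofFinite ι
  rintro b c hbc ⟨f, hf, hf0⟩
  obtain ⟨t, rfl⟩ := le_iff_exists_add.1 hbc
  have ht : mdeg ρ (∑ i, Finsupp.single (p₀ i) (t i)) = t := by
    rw [mdeg, map_sum]
    simp only [← mdeg.eq_1, mdeg_single, hp]
    exact Finset.univ_sum_single t
  refine ⟨f * monomial (∑ i, Finsupp.single (p₀ i) (t i)) 1,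
    ⟨I.mul_mem_right _ hf.1, hf.2.mul (isWeightedHomogeneous_monomial _ _ _ ht)⟩,
    mul_ne_zero hf0 (by simp)⟩

theorem sum_single_apply_of_injective [Fintype ι] (h : Function.Injective p₀) (b : ι → ℕ) (i : ι) :
    (∑ j, Finsupp.single (p₀ j) (b j)) (p₀ i) = b i := by
  classical
  rw [Finsupp.finsetSum_apply, Finset.sum_eq_single i]
  · exact Finsupp.single_eq_same
  · intro j _ hj
    exact Finsupp.single_eq_of_ne fun hji => hj (h hji).symm
  · exact fun hi => (hi (Finset.mem_univ i)).elim

theorem sum_single_le_iff [Fintype ι] (h : Function.Injective p₀) {b : ι → ℕ} {u : σ →₀ ℕ} :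
    ∑ j, Finsupp.single (p₀ j) (b j) ≤ u ↔ ∀ i, b i ≤ u (p₀ i) := by
  classical
  refine ⟨fun hle i => (sum_single_apply_of_injective h b i).symm.le.trans (hle _),
    fun hle p => ?_⟩
  by_cases hp : ∃ i, p = p₀ i
  · obtain ⟨i, rfl⟩ := hp
    exact (sum_single_apply_of_injective h b i).le.trans (hle i)
  · rw [Finsupp.finsetSum_apply, Finset.sum_eq_zero]
    · exact Nat.zero_le _
    · intro j _
      exact Finsupp.single_eq_of_ne fun hj => hp ⟨j, hj⟩

/-- The Hilbert function of an ideal is bounded below in terms of its support. -/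
theorem ncard_cylSet_degSet_le_gh [Infinite K] [Finite σ] [Finite ι] (hp : ∀ i, ρ (p₀ i) = i)
    (I : Ideal (MvPolynomial σ K)) (a : ι → ℕ) :
    (cylSet ρ p₀ (degSet ρ I) a).ncard ≤ gh ρ I a := by
  classical
  have := Fintype.ofFinite ι
  have := Fintype.ofFinite σ
  choose! f hf hf0 using fun (b : ι → ℕ) (hb : b ∈ degSet ρ I) => hb
  let P : MvPolynomial σ K :=
    (∏ b ∈ (Set.finite_Iic a).toFinset with b ∈ degSet ρ I, f b) * ∏ i, X (p₀ i)
  have hP : P ≠ 0 := by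
    refine mul_ne_zero (Finset.prod_ne_zero_iff.2 fun b hb => hf0 b (Finset.mem_filter.1 hb).2)
      (Finset.prod_ne_zero_iff.2 fun i _ => X_ne_zero _)
  obtain ⟨c, hc⟩ : ∃ c, eval c P ≠ 0 := by
    by_contra! h
    exact hP (MvPolynomial.funext fun c => by rw [h c, map_zero])
  rw [map_mul, map_prod, map_prod, mul_ne_zero_iff, Finset.prod_ne_zero_iff,
    Finset.prod_ne_zero_iff] at hc
  obtain ⟨hcf, hcX⟩ := hc
  replace hcf : ∀ b ≤ a, b ∈ degSet ρ I → eval c (f b) ≠ 0 := fun b hba hb =>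
    hcf b (by simp [hba, hb])
  replace hcX : ∀ i, c (p₀ i) ≠ 0 := fun i => by simpa using hcX i (Finset.mem_univ i)
  obtain ⟨e, he, heg, heg'⟩ := exists_algEquiv_shear hp hcX
  rw [← gh_comap_algEquiv ρ e.symm heg' heg I a]
  obtain ⟨key, hkey, hmono, -, hθ⟩ := exists_key
    (∑ i, (Nat.castAddMonoidHom ℤ).comp (Finsupp.applyAddHom (p₀ i)) : (σ →₀ ℕ) →+ ℤ)
  have hθ' : ∀ u w : σ →₀ ℕ, key u ≤ key w → ∑ i, u (p₀ i) ≤ ∑ i, w (p₀ i) := fun u w h => by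
    have := hθ u w h
    simp only [AddMonoidHom.finsetSum_apply, AddMonoidHom.comp_apply,
      Finsupp.applyAddHom_apply, Nat.coe_castAddMonoidHom] at this
    exact_mod_cast this
  rw [gh_eq_ncard_inSet ρ hkey]
  refine Set.ncard_le_ncard (fun u hu => ⟨hu.1, ?_⟩) (finite_of_mdeg ρ a fun u hu => hu.1)
  obtain ⟨hua, hub⟩ := hu
  set b : ι → ℕ := fun i => u (p₀ i) with hb
  have hba : b ≤ a := fun i => by
    have := le_mdeg ρ u (p₀ i)
    rwa [hua, hp] at this
  have hev := hcf b hba hub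
  rw [← eval_shear hp, ← he] at hev
  have hhom : (e (f b)).IsWeightedHomogeneous (rowWt ρ) b := heg _ _ (hf b hub).2
  obtain ⟨w, hw, hw0⟩ : ∃ w ∈ (e (f b)).support, ∀ p ∈ w.support, p = p₀ (ρ p) := by
    by_contra! h
    refine hev ?_
    rw [eval_eq']
    refine Finset.sum_eq_zero fun w hw => ?_
    obtain ⟨p, hpw, hpp⟩ := h w hw
    rw [Finset.prod_eq_zero (Finset.mem_univ p), mul_zero]
    rw [if_neg hpp, zero_pow (Finsupp.mem_support_iff.1 hpw)]
  have hwb : ∀ i, w (p₀ i) = b i := by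
    intro i
    rw [← mdeg_eq_of_mem_support ρ hhom hw, mdeg_apply, Finset.sum_eq_single (p₀ i)]
    · intro p hpi hne
      by_contra h
      refine hne ?_
      rw [← (Finset.mem_filter.1 hpi).2]
      exact hw0 p (Finsupp.mem_support_iff.2 h)
    · simp [hp]
  have hwu : w ≤ u := by
    intro p
    by_cases h : p ∈ w.support
    · rw [hw0 p h, hwb]
    · rw [Finsupp.notMem_support_iff.1 h]
      exact Nat.zero_le _
  refine isUpperSet_inSet ρ hmono _ hwu
    (mem_inSet_of_mem ρ (f := e (f b)) (a := b) ⟨?_, hhom⟩ hw ?_)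
  · change e.symm (e (f b)) ∈ I
    rw [e.symm_apply_apply]
    exact (hf b hub).1
  · intro w' hw'
    by_contra hlt
    have hle : ∀ i, w' (p₀ i) ≤ w (p₀ i) := fun i => by
      have := le_mdeg ρ w' (p₀ i)
      rwa [mdeg_eq_of_mem_support ρ hhom hw', hp, ← hwb] at this
    have heq := (Finset.sum_eq_sum_iff_of_le fun i _ => hle i).1
      (le_antisymm (Finset.sum_le_sum fun i _ => hle i) (hθ' _ _ (not_le.1 hlt).le))
    have hww : w ≤ w' := by
      intro p
      by_cases h : p ∈ w.support
      · rw [hw0 p h, heq _ (Finset.mem_univ _)]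
      · rw [Finsupp.notMem_support_iff.1 h]
        exact Nat.zero_le _
    obtain ⟨t, rfl⟩ := le_iff_exists_add.1 hww
    have ht := mdeg_eq_of_mem_support ρ hhom hw'
    rw [mdeg_add, mdeg_eq_of_mem_support ρ hhom hw, add_eq_left] at ht
    have : t = 0 := by
      ext q
      have := le_mdeg ρ t q
      rw [ht] at this
      simpa using this
    rw [this, add_zero] at hlt
    exact hlt le_rfl

end Star

section StarHilbert
variable {K : Type} [Field K] {v : ℕ} {n : Fin v → ℕ}

theorem Tmono_le_iff {b : Fin v → ℕ} {u : MVar v n →₀ ℕ} :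
    Tmono v n b ≤ u ↔ ∀ i, b i ≤ u ⟨i, 0⟩ :=
  sum_single_le_iff (p₀ := fun i => (⟨i, 0⟩ : MVar v n)) fun _ _ h => congrArg Sigma.fst h

theorem mdeg_Tmono (b : Fin v → ℕ) : mdeg (Sigma.fst : MVar v n → Fin v) (Tmono v n b) = b := by
  rw [mdeg, Tmono, map_sum]
  simp only [← mdeg.eq_1, mdeg_single]
  exact Finset.univ_sum_single b

theorem gh_span_Tmono (A : Set (Fin v → ℕ)) (a : Fin v → ℕ) :
    gh Sigma.fst (Ideal.span ((fun a => monomial (Tmono v n a) (1 : K)) '' A)) a =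
      (cylSet (Sigma.fst : MVar v n → Fin v) (fun i => ⟨i, 0⟩) (upperClosure A) a).ncard := by
  refine gh_eq_ncard_of_mem_iff Sigma.fst _ {u | (fun i => u ⟨i, 0⟩) ∈ upperClosure A}
    (fun f => ?_) a
  rw [← Set.image_image (fun u => monomial u (1 : K)) (Tmono v n), mem_ideal_span_monomial_image]
  refine forall₂_congr fun u _ => ?_
  simp only [Set.exists_mem_image, Tmono_le_iff]
  exact mem_upperClosure.symm

theorem degSet_eq_of_gh_eq_ncard_cylSet {I : Ideal (MvPolynomial (MVar v n) K)}
    {U : Set (Fin v → ℕ)} (hU : IsUpperSet U)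
    (h : ∀ a, gh Sigma.fst I a =
      (cylSet (Sigma.fst : MVar v n → Fin v) (fun i => ⟨i, 0⟩) U a).ncard) :
    degSet Sigma.fst I = U := by
  ext b
  rw [mem_degSet_iff_gh_ne_zero, h, ← Nat.pos_iff_ne_zero,
    Set.ncard_pos (finite_cylSet _ _ _ _)]
  constructor
  · rintro ⟨u, rfl, hu⟩
    exact hU (fun i => le_mdeg Sigma.fst u ⟨i, 0⟩) hu
  · intro hb
    refine ⟨Tmono v n b, mdeg_Tmono b, hU (fun i => ?_) hb⟩
    exact Tmono_le_iff.1 le_rfl i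

theorem isCSstar_iff {I : Ideal (MvPolynomial (MVar v n) K)} :
    IsCSstar I ↔ IsMultigraded I ∧ ∀ a, gh Sigma.fst I a =
      (cylSet (Sigma.fst : MVar v n → Fin v) (fun i => ⟨i, 0⟩) (degSet Sigma.fst I) a).ncard := by
  refine and_congr_right fun _ => ⟨?_, fun h => ?_⟩
  · rintro ⟨C, ⟨A, rfl⟩, h⟩ a
    have hg := fun a => (h a).trans (gh_span_Tmono A a)
    rw [degSet_eq_of_gh_eq_ncard_cylSet (upperClosure A).upper hg]
    exact hg a
  · refine ⟨_, ⟨degSet Sigma.fst I, rfl⟩, fun a => ?_⟩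
    have hU : IsUpperSet (degSet (Sigma.fst : MVar v n → Fin v) I) :=
      isUpperSet_degSet (p₀ := fun i => ⟨i, 0⟩) (fun _ => rfl) I
    rw [hilb_eq_gh, hilb_eq_gh, gh_span_Tmono, h, hU.upperClosure]

end StarHilbert

section GradedQuotient
variable {σ σ' ι K : Type} [DecidableEq ι] [Field K]

/-- `π` presents the quotient by the linear form `L` of degree `e_i` as a graded polynomial
ring. -/
structure IsLinearQuotient (ρ : σ → ι) (ρ' : σ' → ι) (i : ι) (L : MvPolynomial σ K)
    (π : MvPolynomial σ K →ₐ[K] MvPolynomial σ' K) : Prop where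
  ne_zero : L ≠ 0
  isWeightedHomogeneous : L.IsWeightedHomogeneous (rowWt ρ) (Pi.single i 1)
  surjective : Function.Surjective π
  graded : ∀ f a, f.IsWeightedHomogeneous (rowWt ρ) a → (π f).IsWeightedHomogeneous (rowWt ρ') a
  eq_zero_iff : ∀ f, π f = 0 ↔ L ∣ f

namespace IsLinearQuotient
variable {ρ : σ → ι} {ρ' : σ' → ι} {i : ι} {L : MvPolynomial σ K}
    {π : MvPolynomial σ K →ₐ[K] MvPolynomial σ' K} (h : IsLinearQuotient ρ ρ' i L π)
  {I : Ideal (MvPolynomial σ K)}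
  (hI : ∀ f ∈ I, ∀ a : ι → ℕ, weightedHomogeneousComponent (rowWt ρ) a f ∈ I)

include h

theorem weightedHomogeneousComponent_map (f : MvPolynomial σ K) (a : ι → ℕ) :
    weightedHomogeneousComponent (rowWt ρ') a (π f) =
      π (weightedHomogeneousComponent (rowWt ρ) a f) := by
  classical
  rw [f.as_sum]
  simp only [map_sum]
  refine Finset.sum_congr rfl fun u _ => ?_
  have hm : (monomial u (coeff u f)).IsWeightedHomogeneous (rowWt ρ) (mdeg ρ u) :=
    isWeightedHomogeneous_monomial _ _ _ rfl
  rw [weightedHomogeneousComponent_of_mem hm, weightedHomogeneousComponent_of_mem (h.graded _ _ hm)]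
  split_ifs
  · rfl
  · rw [map_zero]

theorem degree_ne_zero_of_dvd {f : MvPolynomial σ K} {a : ι → ℕ}
    (hf : f.IsWeightedHomogeneous (rowWt ρ) a) (hf0 : f ≠ 0) (hLf : L ∣ f) : a i ≠ 0 := by
  classical
  obtain ⟨g, rfl⟩ := hLf
  obtain ⟨u, hu⟩ := support_nonempty.2 hf0
  obtain ⟨w, hw, t, -, rfl⟩ := Finset.mem_add.1 (support_mul _ _ hu)
  rw [← mdeg_eq_of_mem_support ρ hf hu, mdeg_add,
    mdeg_eq_of_mem_support ρ h.isWeightedHomogeneous hw]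
  simp

theorem gh_inf_span_add (a : ι → ℕ) :
    gh ρ (I ⊓ Ideal.span {L}) (a + Pi.single i 1) = gh ρ (I.colon (Ideal.span {L})) a := by
  have hmap : (ghSub ρ (I.colon (Ideal.span {L})) a).map (LinearMap.mulRight K L) =
      ghSub ρ (I ⊓ Ideal.span {L}) (a + Pi.single i 1) := by
    ext f
    constructor
    · rintro ⟨g, hg, rfl⟩
      exact ⟨⟨Ideal.mem_colon_span_singleton.1 hg.1,
        Ideal.mem_span_singleton.2 (Dvd.intro_left g rfl)⟩, hg.2.mul h.isWeightedHomogeneous⟩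
    · rintro ⟨⟨hfI, hfL⟩, hf⟩
      obtain ⟨g, rfl⟩ := Ideal.mem_span_singleton.1 hfL
      have hg : L * g = weightedHomogeneousComponent (rowWt ρ) a g * L := by
        rw [← weightedHomogeneousComponent_mul_of_right h.isWeightedHomogeneous, mul_comm g]
        exact hf.weightedHomogeneousComponent_same.symm
      refine ⟨weightedHomogeneousComponent (rowWt ρ) a g, ⟨Ideal.mem_colon_span_singleton.2 ?_,
        weightedHomogeneousComponent_isWeightedHomogeneous _ _⟩, hg.symm⟩
      rw [← hg]
      exact hfI
  rw [gh, gh, ← hmap]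
  refine (LinearEquiv.finrank_eq (Submodule.equivMapOfInjective _ ?_ _)).symm
  exact mul_left_injective₀ h.ne_zero

theorem gh_inf_span_of_eq_zero {a : ι → ℕ} (ha : a i = 0) :
    gh ρ (I ⊓ Ideal.span {L}) a = 0 := by
  have : ghSub ρ (I ⊓ Ideal.span {L}) a = ⊥ := by
    rw [Submodule.eq_bot_iff]
    intro f hf
    by_contra hf0
    exact h.degree_ne_zero_of_dvd hf.2 hf0 (Ideal.mem_span_singleton.1 hf.1.2) ha
  rw [gh, this, finrank_bot]

include hI

theorem gh_inf_span_add_gh_map [Finite σ] (a : ι → ℕ) :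
    gh ρ (I ⊓ Ideal.span {L}) a + gh ρ' (I.map π) a = gh ρ I a := by
  let φ := π.toLinearMap ∘ₗ (ghSub ρ I a).subtype
  have hrange : LinearMap.range φ = ghSub ρ' (I.map π) a := by
    ext g
    constructor
    · rintro ⟨⟨f, hf⟩, rfl⟩
      exact ⟨Ideal.mem_map_of_mem _ hf.1, h.graded _ _ hf.2⟩
    · rintro ⟨hg, hga⟩
      obtain ⟨f, hf, rfl⟩ := (Ideal.mem_map_iff_of_surjective π h.surjective).1 hg
      refine ⟨⟨weightedHomogeneousComponent (rowWt ρ) a f, hI f hf a,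
        weightedHomogeneousComponent_isWeightedHomogeneous _ _⟩, ?_⟩
      refine (h.weightedHomogeneousComponent_map f a).symm.trans ?_
      exact hga.weightedHomogeneousComponent_same
  have hker : (LinearMap.ker φ).map (ghSub ρ I a).subtype = ghSub ρ (I ⊓ Ideal.span {L}) a := by
    ext f
    constructor
    · rintro ⟨⟨f, hf⟩, hf0, rfl⟩
      exact ⟨⟨hf.1, Ideal.mem_span_singleton.2 ((h.eq_zero_iff f).1 hf0)⟩, hf.2⟩
    · rintro ⟨⟨hf, hfL⟩, hfa⟩
      exact ⟨⟨f, hf, hfa⟩, (h.eq_zero_iff f).2 (Ideal.mem_span_singleton.1 hfL), rfl⟩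
  rw [gh, gh, gh, ← hrange, ← hker, Submodule.finrank_map_subtype_eq, add_comm]
  exact φ.finrank_range_add_finrank_ker

theorem component_mem_map (g : MvPolynomial σ' K) (hg : g ∈ I.map π) (a : ι → ℕ) :
    weightedHomogeneousComponent (rowWt ρ') a g ∈ I.map π := by
  obtain ⟨f, hf, rfl⟩ := (Ideal.mem_map_iff_of_surjective π h.surjective).1 hg
  rw [h.weightedHomogeneousComponent_map]
  exact Ideal.mem_map_of_mem _ (hI f hf a)

theorem component_mem_inf (f : MvPolynomial σ K) (hf : f ∈ I ⊓ Ideal.span {L}) (a : ι → ℕ) :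
    weightedHomogeneousComponent (rowWt ρ) a f ∈ I ⊓ Ideal.span {L} := by
  refine ⟨hI f hf.1 a, Ideal.mem_span_singleton.2 ((h.eq_zero_iff _).1 ?_)⟩
  rw [← h.weightedHomogeneousComponent_map,
    (h.eq_zero_iff f).2 (Ideal.mem_span_singleton.1 hf.2), map_zero]

end IsLinearQuotient
end GradedQuotient

section AddSingle
variable {σ ι : Type} [DecidableEq ι] {ρ : σ → ι} {p₀ : ι → σ}

theorem exists_eq_add_single {b : ι → ℕ} {i : ι} (hb : b i ≠ 0) :
    ∃ c : ι → ℕ, b = c + Pi.single i 1 := by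
  refine ⟨b - Pi.single i 1, _root_.funext fun j => ?_⟩
  by_cases hj : j = i
  · subst hj
    rw [Pi.add_apply, Pi.sub_apply, Pi.single_eq_same]
    omega
  · simp [hj]

theorem add_single_comp (hp : ∀ j, ρ (p₀ j) = j) (u : σ →₀ ℕ) (i : ι) :
    (fun j => (u + Finsupp.single (p₀ i) 1 : σ →₀ ℕ) (p₀ j)) =
      (fun j => u (p₀ j)) + Pi.single i 1 := by
  refine _root_.funext fun j => ?_
  rw [Finsupp.add_apply, Pi.add_apply]
  by_cases hj : j = i
  · subst hj
    rw [Finsupp.single_eq_same, Pi.single_eq_same]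
  · rw [Pi.single_eq_of_ne hj, Finsupp.single_eq_of_ne fun h => hj (by rw [← hp j, h, hp])]

theorem exists_eq_add_single_of_comp_eq (hp : ∀ j, ρ (p₀ j) = j) {u : σ →₀ ℕ} {c : ι → ℕ} {i : ι}
    (huc : (fun j => u (p₀ j)) = c + Pi.single i 1) :
    ∃ w, u = w + Finsupp.single (p₀ i) 1 ∧ (fun j => w (p₀ j)) = c := by
  have h1 : Finsupp.single (p₀ i) 1 ≤ u := by
    have := congrFun huc i
    rw [Pi.add_apply, Pi.single_eq_same] at this
    exact Finsupp.single_le_iff.2 (this ▸ Nat.le_add_left _ _)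
  obtain ⟨w, rfl⟩ := le_iff_exists_add'.1 h1
  refine ⟨w, rfl, ?_⟩
  rw [add_single_comp hp] at huc
  exact add_right_cancel huc

theorem exists_mem_support_of_mdeg_ne_zero [Finite σ] {u : σ →₀ ℕ} {i : ι} (h : mdeg ρ u i ≠ 0) :
    ∃ p, u p ≠ 0 ∧ ρ p = i := by
  classical
  have := Fintype.ofFinite σ
  rw [mdeg_apply] at h
  obtain ⟨p, hp, hne⟩ := Finset.exists_ne_zero_of_sum_ne_zero h
  exact ⟨p, hne, (Finset.mem_filter.1 hp).2⟩

end AddSingle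

section Merge
variable {σ σ' ι : Type} [DecidableEq ι] {ρ : σ → ι} {ρ' : σ' → ι} {p₀ : ι → σ} {p₀' : ι → σ'}
  {i : ι}

/-- `f` is a degree preserving map of variables which identifies the variable `y` with `p₀ i`
and is injective otherwise. -/
structure IsMerge (ρ : σ → ι) (ρ' : σ' → ι) (p₀ : ι → σ) (p₀' : ι → σ') (i : ι) (y : σ)
    (f : σ → σ') : Prop where
  row : ∀ p, ρ' (f p) = ρ p
  base : ∀ j, f (p₀ j) = p₀' j
  ne : y ≠ p₀ i
  map_eq : f y = p₀' i
  inj : ∀ p q, p ≠ y → q ≠ y → f p = f q → p = q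

namespace IsMerge
variable {y : σ} {f : σ → σ'} (h : IsMerge ρ ρ' p₀ p₀' i y f)
include h

theorem mdeg_mapDomain (u : σ →₀ ℕ) : mdeg ρ' (u.mapDomain f) = mdeg ρ u := by
  rw [← coe_mapDomain_eq_mdeg, ← coe_mapDomain_eq_mdeg, ← Finsupp.mapDomain_comp]
  congr 2
  exact _root_.funext h.row

theorem mapDomain_apply [Finite σ] (u : σ →₀ ℕ) {q : σ} (hqy : q ≠ y) (hq : q ≠ p₀ i) :
    u.mapDomain f (f q) = u q := by
  classical
  have := Fintype.ofFinite σ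
  rw [Finsupp.mapDomain, Finsupp.sum_fintype _ _ (by simp), Finsupp.finsetSum_apply,
    Finset.sum_eq_single q]
  · exact Finsupp.single_eq_same
  · intro p _ hpq
    refine Finsupp.single_eq_of_ne fun hpf => ?_
    by_cases hpy : p = y
    · subst hpy
      rw [h.map_eq, ← h.base] at hpf
      exact hq (h.inj _ _ hqy h.ne.symm hpf)
    · exact hpq (h.inj _ _ hpy hqy hpf.symm)
  · simp

theorem mapDomain_apply_base [Finite σ] (u : σ →₀ ℕ) :
    u.mapDomain f (p₀' i) = u (p₀ i) + u y := by
  classical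
  have := Fintype.ofFinite σ
  rw [Finsupp.mapDomain, Finsupp.sum_fintype _ _ (by simp), Finsupp.finsetSum_apply,
    Finset.sum_eq_add_of_mem (p₀ i) y (Finset.mem_univ _) (Finset.mem_univ _) h.ne.symm]
  · rw [h.base, h.map_eq, Finsupp.single_eq_same, Finsupp.single_eq_same]
  · rintro p - ⟨hp, hpy⟩
    refine Finsupp.single_eq_of_ne fun hpf => ?_
    rw [← h.base] at hpf
    exact hp (h.inj _ _ hpy h.ne.symm hpf.symm)

theorem ncard_cylSet_le [Finite σ] [Finite σ'] (hp : ∀ j, ρ (p₀ j) = j)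
    {U U' : Set (ι → ℕ)} {V : Set (ι → ℕ)} (hU' : IsUpperSet U') (hV : IsUpperSet V) (hUU' : U ⊆ U')
    (hU : ∀ b ∈ U, b ∈ V ∨ ∃ c ∈ U', b = c + Pi.single i 1) (a : ι → ℕ) :
    (cylSet ρ p₀ U a).ncard ≤
      {u | mdeg ρ u + Pi.single i 1 = a ∧ (fun j => u (p₀ j)) ∈ U'}.ncard +
        (cylSet ρ' p₀' V a).ncard := by
  classical
  have hpinj : ∀ {j k}, p₀ j = p₀ k → j = k := fun {j k} hjk => by rw [← hp j, hjk, hp]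
  have hyj : ∀ j, j ≠ i → p₀ j ≠ y := by
    rintro j hj rfl
    have h1 := h.row (p₀ j)
    rw [h.map_eq, ← h.base, h.row, hp, hp] at h1
    exact hj h1.symm
  have not_lt_of_off : ∀ {u w : σ →₀ ℕ}, (fun j => u (p₀ j)) ∈ U →
      ¬ (∃ c ∈ U', (fun j => w (p₀ j)) = c + Pi.single i 1) →
      (∀ q, q ≠ y → q ≠ p₀ i → u q = w q) → ¬ u (p₀ i) < w (p₀ i) := by
    intro u w hu hw hoff hlt
    obtain ⟨c, hc⟩ := exists_eq_add_single (b := fun j => w (p₀ j)) (i := i) (by omega)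
    refine hw ⟨c, hU' (fun j => ?_) (hUU' hu), hc⟩
    have hcj := congrFun hc j
    by_cases hj : j = i
    · subst hj
      rw [Pi.add_apply, Pi.single_eq_same] at hcj
      change u (p₀ j) ≤ c j
      omega
    · rw [Pi.add_apply, Pi.single_eq_of_ne hj, add_zero] at hcj
      rw [← hcj]
      exact (hoff _ (hyj j hj) fun hji => hj (hpinj hji)).le
  refine ncard_le_add_of_injOn ?_ (finite_cylSet _ _ _ _)
    (fun u => ∃ c ∈ U', (fun j => u (p₀ j)) = c + Pi.single i 1)
    (fun u => u - Finsupp.single (p₀ i) 1) (fun u => u.mapDomain f) ?_ ?_ ?_ ?_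
  · by_cases ha : ∃ c : ι → ℕ, c + Pi.single i 1 = a
    · obtain ⟨c, rfl⟩ := ha
      exact finite_of_mdeg ρ c fun u hu => add_right_cancel hu.1
    · exact Set.Finite.subset Set.finite_empty fun u hu => ha ⟨_, hu.1⟩
  · rintro u ⟨hua, -⟩ ⟨c, hc, huc⟩
    obtain ⟨w, rfl, rfl⟩ := exists_eq_add_single_of_comp_eq hp huc
    rw [mdeg_add, mdeg_single, hp] at hua
    rw [add_tsub_cancel_right]
    exact ⟨hua, hc⟩
  · rintro u ⟨hua, hub⟩ hu
    refine ⟨(h.mdeg_mapDomain u).trans hua, hV (fun j => ?_) ((hU _ hub).resolve_right hu)⟩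
    change u (p₀ j) ≤ u.mapDomain f (p₀' j)
    by_cases hj : j = i
    · subst hj
      rw [h.mapDomain_apply_base]
      exact Nat.le_add_right _ _
    · rw [← h.base, h.mapDomain_apply _ (hyj j hj) fun hji => hj (hpinj hji)]
  · rintro u - ⟨c, -, huc⟩ w - ⟨d, -, hwd⟩ huw
    obtain ⟨u', rfl, -⟩ := exists_eq_add_single_of_comp_eq hp huc
    obtain ⟨w', rfl, -⟩ := exists_eq_add_single_of_comp_eq hp hwd
    rw [add_tsub_cancel_right, add_tsub_cancel_right] at huw
    rw [huw]
  · rintro u ⟨-, hub⟩ hu w ⟨-, hwb⟩ hw (huw : u.mapDomain f = w.mapDomain f)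
    have hoff : ∀ q, q ≠ y → q ≠ p₀ i → u q = w q := fun q hqy hq => by
      rw [← h.mapDomain_apply u hqy hq, huw, h.mapDomain_apply w hqy hq]
    have hbase : u (p₀ i) + u y = w (p₀ i) + w y := by
      rw [← h.mapDomain_apply_base, huw, h.mapDomain_apply_base]
    have hle := not_lt_of_off hub hw hoff
    have hge := not_lt_of_off hwb hu fun q hqy hq => (hoff q hqy hq).symm
    ext q
    by_cases hq : q = p₀ i
    · subst hq
      omega
    by_cases hqy : q = y
    · subst hqy
      omega
    · exact hoff q hqy hq

end IsMerge
end Merge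

section Main
variable {σ σ' ι K : Type} [DecidableEq ι] [Finite ι] [Finite σ] [Finite σ'] [Field K] [Infinite K]
  {ρ : σ → ι} {ρ' : σ' → ι} {p₀ : ι → σ} {p₀' : ι → σ'} {i : ι} {L : MvPolynomial σ K}
  {π : MvPolynomial σ K →ₐ[K] MvPolynomial σ' K} {I : Ideal (MvPolynomial σ K)}

theorem degSet_subset_colon : degSet ρ I ⊆ degSet ρ (I.colon (Ideal.span {L})) := by
  rintro b ⟨f, hf, hf0⟩
  exact ⟨f, ⟨Ideal.mem_colon_span_singleton.2 (I.mul_mem_right _ hf.1), hf.2⟩, hf0⟩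

namespace IsLinearQuotient
variable (h : IsLinearQuotient ρ ρ' i L π)
  (hI : ∀ f ∈ I, ∀ a : ι → ℕ, weightedHomogeneousComponent (rowWt ρ) a f ∈ I)
  (hp : ∀ j, ρ (p₀ j) = j)
  (hstar : ∀ a, gh ρ I a = (cylSet ρ p₀ (degSet ρ I) a).ncard)
include h hI

theorem gh_add_single (a : ι → ℕ) :
    gh ρ (I.colon (Ideal.span {L})) a + gh ρ' (I.map π) (a + Pi.single i 1) =
      gh ρ I (a + Pi.single i 1) := by
  rw [← h.gh_inf_span_add, h.gh_inf_span_add_gh_map hI]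

theorem gh_map_of_eq_zero {a : ι → ℕ} (ha : a i = 0) : gh ρ' (I.map π) a = gh ρ I a := by
  rw [← h.gh_inf_span_add_gh_map hI, h.gh_inf_span_of_eq_zero ha, zero_add]

theorem mem_degSet_map_or {b : ι → ℕ} (hb : b ∈ degSet ρ I) : b ∈ degSet ρ' (I.map π) ∨
    ∃ c ∈ degSet ρ (I.colon (Ideal.span {L})), b = c + Pi.single i 1 := by
  by_cases hbi : b i = 0
  · left
    rwa [mem_degSet_iff_gh_ne_zero, h.gh_map_of_eq_zero hI hbi, ← mem_degSet_iff_gh_ne_zero]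
  · obtain ⟨c, rfl⟩ := exists_eq_add_single hbi
    have := h.gh_add_single hI c
    rw [mem_degSet_iff_gh_ne_zero] at hb ⊢
    by_cases h0 : gh ρ' (I.map π) (c + Pi.single i 1) = 0
    · right
      refine ⟨c, ?_, rfl⟩
      rw [mem_degSet_iff_gh_ne_zero]
      omega
    · exact Or.inl h0

include hp hstar

theorem gh_eq_ncard_of_isMerge (hp' : ∀ j, ρ' (p₀' j) = j) {y : σ} {f : σ → σ'}
    (hf : IsMerge ρ ρ' p₀ p₀' i y f) :
    (∀ a, gh ρ (I.colon (Ideal.span {L})) a =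
      (cylSet ρ p₀ (degSet ρ (I.colon (Ideal.span {L}))) a).ncard) ∧
    ∀ a, gh ρ' (I.map π) a = (cylSet ρ' p₀' (degSet ρ' (I.map π)) a).ncard := by
  have key := hf.ncard_cylSet_le hp (isUpperSet_degSet hp (I.colon (Ideal.span {L})))
    (isUpperSet_degSet hp' (I.map π)) degSet_subset_colon
    fun b hb => h.mem_degSet_map_or hI hb
  have hl := ncard_cylSet_degSet_le_gh hp (I.colon (Ideal.span {L}))
  have hl' := ncard_cylSet_degSet_le_gh hp' (I.map π)
  have hadd : ∀ a, gh ρ (I.colon (Ideal.span {L})) a + gh ρ' (I.map π) (a + Pi.single i 1) ≤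
      (cylSet ρ p₀ (degSet ρ (I.colon (Ideal.span {L}))) a).ncard +
        (cylSet ρ' p₀' (degSet ρ' (I.map π)) (a + Pi.single i 1)).ncard := fun a => by
    have h1 := key (a + Pi.single i 1)
    simp only [add_left_inj] at h1
    rw [h.gh_add_single hI, hstar]
    exact h1
  refine ⟨fun a => ?_, fun a => ?_⟩
  · have h1 := hadd a
    have h2 := hl a
    have h3 := hl' (a + Pi.single i 1)
    omega
  · by_cases ha : a i = 0
    · refine le_antisymm ?_ (hl' a)
      rw [h.gh_map_of_eq_zero hI ha, hstar]
      refine (key a).trans ?_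
      have : {u | mdeg ρ u + Pi.single i 1 = a ∧
          (fun j => u (p₀ j)) ∈ degSet ρ (I.colon (Ideal.span {L}))} = ∅ := by
        refine Set.eq_empty_of_forall_notMem fun u hu => ?_
        have := congrFun hu.1 i
        simp [ha] at this
      rw [this, Set.ncard_empty, zero_add]
    · obtain ⟨c, rfl⟩ := exists_eq_add_single ha
      have h1 := hadd c
      have h2 := hl c
      have h3 := hl' (c + Pi.single i 1)
      omega

/-- The case in which `L` is a multiple of the only variable of degree `e_i`. -/
theorem gh_colon_of_subsingleton (hi : ∀ p, ρ p = i → p = p₀ i) (hi' : ∀ p, ρ' p ≠ i) (a : ι → ℕ) :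
    gh ρ (I.colon (Ideal.span {L})) a =
      (cylSet ρ p₀ (degSet ρ (I.colon (Ideal.span {L}))) a).ncard := by
  have hzero : ∀ (b : ι → ℕ), b i ≠ 0 → gh ρ' (I.map π) b = 0 := fun b hb => by
    by_contra hne
    obtain ⟨g, hg, hg0⟩ := mem_degSet_iff_gh_ne_zero.2 hne
    obtain ⟨u, hu⟩ := support_nonempty.2 hg0
    rw [← mdeg_eq_of_mem_support ρ' hg.2 hu] at hb
    obtain ⟨p, -, hpi⟩ := exists_mem_support_of_mdeg_ne_zero hb
    exact hi' p hpi
  refine le_antisymm ?_ (ncard_cylSet_degSet_le_gh hp _ a)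
  have h1 := h.gh_add_single hI a
  rw [hzero _ (by simp), add_zero, hstar] at h1
  rw [h1]
  have key : ∀ u ∈ cylSet ρ p₀ (degSet ρ I) (a + Pi.single i 1),
      ∃ w ∈ cylSet ρ p₀ (degSet ρ (I.colon (Ideal.span {L}))) a,
        u = w + Finsupp.single (p₀ i) 1 := by
    rintro u ⟨hua, hub⟩
    have hui : u (p₀ i) ≠ 0 := by
      obtain ⟨p, hpu, hpi⟩ := exists_mem_support_of_mdeg_ne_zero (ρ := ρ) (u := u) (i := i)
        (by rw [hua]; simp)
      rwa [← hi p hpi]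
    obtain ⟨c, hc, huc⟩ := (h.mem_degSet_map_or hI hub).resolve_left fun hV =>
      mem_degSet_iff_gh_ne_zero.1 hV (hzero _ hui)
    obtain ⟨w, rfl, rfl⟩ := exists_eq_add_single_of_comp_eq hp huc
    rw [mdeg_add, mdeg_single, hp] at hua
    exact ⟨w, ⟨add_right_cancel hua, hc⟩, rfl⟩
  refine Set.ncard_le_ncard_of_injOn (fun u => u - Finsupp.single (p₀ i) 1) ?_ ?_
    (finite_cylSet _ _ _ _)
  · intro u hu
    obtain ⟨w, hw, rfl⟩ := key u hu
    rwa [add_tsub_cancel_right]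
  · intro u hu w hw huw
    obtain ⟨u', -, rfl⟩ := key u hu
    obtain ⟨w', -, rfl⟩ := key w hw
    simp only [add_tsub_cancel_right] at huw
    rw [huw]

theorem gh_inf_eq_ncard (hc : ∀ a, gh ρ (I.colon (Ideal.span {L})) a =
      (cylSet ρ p₀ (degSet ρ (I.colon (Ideal.span {L}))) a).ncard) (a : ι → ℕ) :
    gh ρ (I ⊓ Ideal.span {L}) a =
      (cylSet ρ p₀ (degSet ρ (I ⊓ Ideal.span {L})) a).ncard := by
  refine le_antisymm ?_ (ncard_cylSet_degSet_le_gh hp _ a)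
  by_cases ha : a i = 0
  · rw [h.gh_inf_span_of_eq_zero ha]
    exact Nat.zero_le _
  obtain ⟨c, rfl⟩ := exists_eq_add_single ha
  rw [h.gh_inf_span_add, hc]
  refine Set.ncard_le_ncard_of_injOn (fun u => u + Finsupp.single (p₀ i) 1) ?_
    (fun u _ w _ huw => add_right_cancel huw) (finite_cylSet _ _ _ _)
  rintro u ⟨rfl, hub⟩
  refine ⟨?_, ?_⟩
  · rw [mdeg_add, mdeg_single, hp]
  · rw [add_single_comp hp, mem_degSet_iff_gh_ne_zero, h.gh_inf_span_add,
      ← mem_degSet_iff_gh_ne_zero]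
    exact hub

end IsLinearQuotient
end Main

section KillVar
variable {σ ι K : Type} [DecidableEq σ] [DecidableEq ι] [Field K] (x : σ)

/-- The quotient map which sets the variable `x` to zero. -/
def killVar : MvPolynomial σ K →ₐ[K] MvPolynomial {p // p ≠ x} K :=
  aeval fun p => if h : p = x then 0 else X ⟨p, h⟩

theorem killVar_X_self : killVar (K := K) x (X x) = 0 := by
  simp [killVar]

theorem killVar_X_coe (p : {p // p ≠ x}) : killVar (K := K) x (X p.1) = X p := by
  simp [killVar, p.2]

theorem killVar_surjective : Function.Surjective (killVar (K := K) x) := by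
  intro f
  refine ⟨rename Subtype.val f, ?_⟩
  have : (killVar (K := K) x).comp (rename Subtype.val) = AlgHom.id K _ := by
    ext p : 1
    simp [killVar_X_coe]
  exact DFunLike.congr_fun this f

theorem killVar_eq_zero_iff (f : MvPolynomial σ K) : killVar x f = 0 ↔ X x ∣ f := by
  constructor
  · intro hf
    have : (Ideal.Quotient.mkₐ K (Ideal.span {(X x : MvPolynomial σ K)})).comp
        ((rename Subtype.val).comp (killVar x)) = Ideal.Quotient.mkₐ K _ := by
      ext p : 1
      by_cases hp : p = x
      · subst hp
        simp only [AlgHom.comp_apply, killVar_X_self, map_zero]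
        exact (Ideal.Quotient.eq_zero_iff_mem.2 (Ideal.mem_span_singleton_self _)).symm
      · simp only [AlgHom.comp_apply, killVar_X_coe x ⟨p, hp⟩, rename_X]
    have := DFunLike.congr_fun this f
    rw [AlgHom.comp_apply, AlgHom.comp_apply, hf, map_zero, map_zero] at this
    exact Ideal.mem_span_singleton.1 (Ideal.Quotient.eq_zero_iff_mem.1 this.symm)
  · rintro ⟨g, rfl⟩
    rw [map_mul, killVar_X_self, zero_mul]

theorem isWeightedHomogeneous_killVar (ρ : σ → ι) {f : MvPolynomial σ K} {a : ι → ℕ}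
    (hf : f.IsWeightedHomogeneous (rowWt ρ) a) :
    (killVar x f).IsWeightedHomogeneous (rowWt fun p : {p // p ≠ x} => ρ p.1) a := by
  refine isWeightedHomogeneous_algHom (killVar x) (fun p => ?_) hf
  by_cases hp : p = x
  · subst hp
    rw [killVar_X_self]
    exact isWeightedHomogeneous_zero _ _ _
  · rw [killVar_X_coe x ⟨p, hp⟩]
    exact isWeightedHomogeneous_X _ _ _

end KillVar

section Top
variable {σ ι K : Type} [Finite σ] [DecidableEq ι] [Field K] (ρ : σ → ι)

theorem gh_top (a : ι → ℕ) :
    gh ρ (⊤ : Ideal (MvPolynomial σ K)) a = {u | mdeg ρ u = a}.ncard := by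
  rw [gh_eq_ncard_of_mem_iff ρ ⊤ Set.univ (by simp)]
  simp

theorem gh_top_single (i : ι) :
    gh ρ (⊤ : Ideal (MvPolynomial σ K)) (Pi.single i 1) = {p | ρ p = i}.ncard := by
  rw [gh_top, ← Set.ncard_image_of_injective {p | ρ p = i}
    (f := fun p : σ => (Finsupp.single p 1 : σ →₀ ℕ)) fun p q h =>
      Finsupp.single_left_injective one_ne_zero h]
  congr 1
  ext u
  constructor
  · intro hu
    obtain ⟨p, hp, rfl⟩ := eq_single_of_mdeg_eq hu
    exact ⟨p, hp, rfl⟩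
  · rintro ⟨p, rfl, rfl⟩
    exact mdeg_single _ p 1

theorem gh_top_zero : gh ρ (⊤ : Ideal (MvPolynomial σ K)) 0 = 1 := by
  rw [gh_top, Set.ncard_eq_one]
  refine ⟨0, Set.eq_singleton_iff_unique_mem.2 ⟨mdeg_zero ρ, fun u hu => ?_⟩⟩
  ext p
  have := le_mdeg (ρ := ρ) u p
  rw [hu] at this
  exact Nat.le_zero.1 this

end Top

section Closure
variable {K : Type} [Field K] {v : ℕ} {n : Fin v → ℕ} {i : Fin v}
  {I : Ideal (MvPolynomial (MVar v n) K)} {L : MvPolynomial (MVar v n) K}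

theorem exists_isLinearQuotient (hL0 : L ≠ 0)
    (hL : L.IsWeightedHomogeneous (wt v n) (Pi.single i 1)) :
    ∃ x : MVar v n, x.1 = i ∧ ∃ π : MvPolynomial (MVar v n) K →ₐ[K] MvPolynomial {p // p ≠ x} K,
      IsLinearQuotient Sigma.fst (fun p => p.1.1) i L π := by
  obtain ⟨e, x, hx, rfl, he, he'⟩ := exists_algEquiv_X hL0 hL
  refine ⟨x, hx, (killVar x).comp e.symm.toAlgHom, hL0, hL,
    (killVar_surjective x).comp e.symm.surjective,
    fun f a hf => isWeightedHomogeneous_killVar x Sigma.fst (he' f a hf), fun f => ?_⟩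
  refine (killVar_eq_zero_iff x (e.symm f)).trans ?_
  rw [← map_dvd_iff e, e.apply_symm_apply]

theorem gh_colon_eq_ncard [Infinite K] (hI : IsCSstar I) (hL0 : L ≠ 0)
    (hL : L.IsWeightedHomogeneous (wt v n) (Pi.single i 1)) (a : Fin v → ℕ) :
    gh Sigma.fst (I.colon (Ideal.span {L})) a = (cylSet (Sigma.fst : MVar v n → Fin v)
      (fun i => ⟨i, 0⟩) (degSet Sigma.fst (I.colon (Ideal.span {L}))) a).ncard := by
  obtain ⟨hm, hstar⟩ := isCSstar_iff.1 hI
  obtain ⟨x, hx, π, hπ⟩ := exists_isLinearQuotient hL0 hL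
  by_cases hy : ∃ y : MVar v n, y.1 = i ∧ y ≠ ⟨i, 0⟩
  · suffices ∃ (y : MVar v n) (f : MVar v n → {p // p ≠ x}),
        IsMerge Sigma.fst (fun p => p.1.1) (fun i => ⟨i, 0⟩) (fun j => f ⟨j, 0⟩) i y f by
      obtain ⟨y, f, hf⟩ := this
      exact (hπ.gh_eq_ncard_of_isMerge hm (fun _ => rfl) hstar (fun j => hf.row _) hf).1 a
    obtain ⟨y, hyi, hy0⟩ := hy
    by_cases hx0 : x = ⟨i, 0⟩
    · subst hx0
      refine ⟨y, fun z => if hz : z = ⟨i, 0⟩ then ⟨y, hy0⟩ else ⟨z, hz⟩,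
        fun p => ?_, fun j => rfl, hy0, ?_, fun p q hp hq hpq => ?_⟩
      · by_cases hp : p = ⟨i, 0⟩ <;> simp [hp, hyi]
      · simp [hy0]
      · by_cases hp0 : p = ⟨i, 0⟩ <;> by_cases hq0 : q = ⟨i, 0⟩ <;>
          simp_all [Subtype.ext_iff]
    · refine ⟨x, fun z => if hz : z = x then ⟨⟨i, 0⟩, Ne.symm hx0⟩ else ⟨z, hz⟩,
        fun p => ?_, fun j => rfl, hx0, ?_, fun p q hp hq hpq => ?_⟩
      · by_cases hp : p = x <;> simp [hp, hx]
      · simp [Ne.symm hx0]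
      · simpa [hp, hq] using hpq
  · push Not at hy
    obtain rfl := hy x hx
    exact hπ.gh_colon_of_subsingleton hm (fun _ => rfl) hstar hy
      (fun p hp => p.2 (hy p.1 hp)) a

theorem isCSstar_colon [Infinite K] (hI : IsCSstar I) (hL0 : L ≠ 0)
    (hL : L.IsWeightedHomogeneous (wt v n) (Pi.single i 1)) :
    IsCSstar (I.colon (Ideal.span {L})) :=
  isCSstar_iff.2 ⟨isMultigraded_colon hI.1 hL, gh_colon_eq_ncard hI hL0 hL⟩

theorem isCSstar_inf [Infinite K] (hI : IsCSstar I) (hL0 : L ≠ 0)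
    (hL : L.IsWeightedHomogeneous (wt v n) (Pi.single i 1)) :
    IsCSstar (I ⊓ Ideal.span {L}) := by
  obtain ⟨hm, hstar⟩ := isCSstar_iff.1 hI
  obtain ⟨x, hx, π, hπ⟩ := exists_isLinearQuotient hL0 hL
  exact isCSstar_iff.2 ⟨hπ.component_mem_inf hm,
    hπ.gh_inf_eq_ncard hm (fun _ => rfl) hstar (gh_colon_eq_ncard hI hL0 hL)⟩

theorem ncard_fst_eq (i : Fin v) : {p : MVar v n | p.1 = i}.ncard = n i + 1 := by
  rw [← Nat.card_fin (n i + 1), ← Set.ncard_univ,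
    ← Set.ncard_image_of_injective Set.univ
      (sigma_mk_injective (β := fun i => Fin (n i + 1)) (i := i))]
  congr 1
  ext ⟨j, k⟩
  constructor
  · rintro rfl
    exact ⟨k, trivial, rfl⟩
  · rintro ⟨k, -, h⟩
    exact (congrArg Sigma.fst h).symm

variable {n₂ : Fin v → ℕ} {π : MvPolynomial (MVar v n) K →ₐ[K] MvPolynomial (MVar v n₂) K}

theorem IsLinearQuotient.eq_add_single [Infinite K]
    (h : IsLinearQuotient Sigma.fst Sigma.fst i L π) :
    n = n₂ + Pi.single i 1 := by
  have htop : ∀ f ∈ (⊤ : Ideal (MvPolynomial (MVar v n) K)), ∀ a : Fin v → ℕ,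
      weightedHomogeneousComponent (rowWt Sigma.fst) a f ∈
        (⊤ : Ideal (MvPolynomial (MVar v n) K)) := fun _ _ _ => trivial
  have hmap : (⊤ : Ideal (MvPolynomial (MVar v n) K)).map π = ⊤ := Ideal.map_top π
  have hcolon : (⊤ : Ideal (MvPolynomial (MVar v n) K)).colon (Ideal.span {L}) = ⊤ := by
    simp
  refine _root_.funext fun j => ?_
  by_cases hj : j = i
  · subst hj
    have h1 := h.gh_add_single htop 0
    rw [zero_add, hmap, hcolon, gh_top_zero, gh_top_single, gh_top_single, ncard_fst_eq,
      ncard_fst_eq] at h1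
    rw [Pi.add_apply, Pi.single_eq_same]
    omega
  · have h1 := h.gh_map_of_eq_zero htop (a := Pi.single j 1) (Pi.single_eq_of_ne (Ne.symm hj) _)
    rw [hmap, gh_top_single, gh_top_single, ncard_fst_eq, ncard_fst_eq] at h1
    rw [Pi.add_apply, Pi.single_eq_of_ne hj]
    omega

theorem IsLinearQuotient.isCSstar_map [Infinite K]
    (h : IsLinearQuotient Sigma.fst Sigma.fst i L π) (hI : IsCSstar I) : IsCSstar (I.map π) := by
  obtain ⟨hm, hstar⟩ := isCSstar_iff.1 hI
  obtain rfl := h.eq_add_single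
  have hi : ∀ j, j = i → (n₂ + Pi.single i 1 : Fin v → ℕ) j = n₂ j + 1 := fun j hj => by
    simp [hj]
  have hj : ∀ j, j ≠ i → (n₂ + Pi.single i 1 : Fin v → ℕ) j = n₂ j := fun j hj => by simp [hj]
  have hf : IsMerge (Sigma.fst : MVar v (n₂ + Pi.single i 1) → Fin v)
      (Sigma.fst : MVar v n₂ → Fin v)
      (fun j => ⟨j, 0⟩) (fun j => ⟨j, 0⟩) i ⟨i, ⟨1, by rw [hi i rfl]; omega⟩⟩
      (fun p => ⟨p.1, ⟨if p.1 = i then p.2 - 1 else p.2, by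
        have := p.2.2
        split_ifs with hp
        · have := hi _ hp
          omega
        · have := hj _ hp
          omega⟩⟩) := by
    refine ⟨fun _ => rfl, fun j => ?_, fun heq => ?_, ?_, ?_⟩
    · simp
    · simp [Fin.ext_iff] at heq
    · simp
    · rintro ⟨j, k⟩ ⟨j', k'⟩ hp hq heq
      obtain rfl : j = j' := congrArg Sigma.fst heq
      simp only [Sigma.mk.injEq, heq_eq_eq, true_and, Fin.mk.injEq] at heq ⊢
      by_cases hji : j = i
      · subst hji
        simp [Fin.ext_iff] at hp hq heq
        omega
      · simpa [hji, Fin.ext_iff] using heq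
  exact isCSstar_iff.2 ⟨h.component_mem_map hm,
    (h.gh_eq_ncard_of_isMerge hm (fun _ => rfl) hstar (fun _ => rfl) hf).2⟩

theorem isCSstar_map_quotient [Infinite K] (hI : IsCSstar I) (hL0 : L ≠ 0)
    (hL : L.IsWeightedHomogeneous (wt v n) (Pi.single i 1))
    (ψ : (MvPolynomial (MVar v n) K ⧸ Ideal.span {L}) ≃ₐ[K] MvPolynomial (MVar v n₂) K)
    (hψ : IsGradedStructureIso (Ideal.span {L}) ψ) :
    IsCSstar (Ideal.map ψ (Ideal.map (Ideal.Quotient.mk (Ideal.span {L}))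
      (I ⊔ Ideal.span {L}))) := by
  let π := ψ.toAlgHom.comp (Ideal.Quotient.mkₐ K (Ideal.span {L}))
  have hπ : IsLinearQuotient Sigma.fst Sigma.fst i L π := by
    refine ⟨hL0, hL, ψ.surjective.comp Ideal.Quotient.mk_surjective, hψ, fun f => ?_⟩
    rw [← Ideal.mem_span_singleton, ← Ideal.Quotient.eq_zero_iff_mem]
    exact EmbeddingLike.map_eq_zero_iff (f := ψ)
  have : Ideal.map ψ (Ideal.map (Ideal.Quotient.mk (Ideal.span {L})) (I ⊔ Ideal.span {L})) =
      I.map π := by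
    rw [Ideal.map_sup, Ideal.map_quotient_self, sup_bot_eq]
    ext g
    rw [Ideal.mem_map_iff_of_surjective ψ ψ.surjective,
      Ideal.mem_map_iff_of_surjective π hπ.surjective]
    constructor
    · rintro ⟨q, hq, rfl⟩
      obtain ⟨f, hf, rfl⟩ :=
        (Ideal.mem_map_iff_of_surjective _ Ideal.Quotient.mk_surjective).1 hq
      exact ⟨f, hf, rfl⟩
    · rintro ⟨f, hf, rfl⟩
      exact ⟨_, Ideal.mem_map_of_mem _ hf, rfl⟩
  rw [this]
  exact hπ.isCSstar_map hI

end Closure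

end CSPaper

/-- **Closure properties (1)-(4).** Let `L` be a `ℤ^v`-graded linear form of `S`.
If `I` is Cartwright-Sturmfels*, then so are `I : L`, the image of `I + (L)` in `S/(L)`
(under any identification of `S/(L)` with a standard `ℤ^v`-graded polynomial ring), and
`I ∩ (L)`.  If `I` is Cartwright-Sturmfels, then so is `I : L`. -/
theorem CSstar_CS_closure_colon_quotient_intersection
    {K : Type} [Field K] [Infinite K] {v : ℕ} {n : Fin v → ℕ}
    (I : Ideal (MvPolynomial (MVar v n) K)) (L : MvPolynomial (MVar v n) K)
    (hL0 : L ≠ 0) (hL : ∃ i : Fin v, L.IsWeightedHomogeneous (wt v n) (Pi.single i 1)) :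
    (IsCSstar I →
      IsCSstar (I.colon (Ideal.span {L})) ∧
      (∀ (n₂ : Fin v → ℕ)
        (ψ : (MvPolynomial (MVar v n) K ⧸ Ideal.span {L}) ≃ₐ[K]
          MvPolynomial (MVar v n₂) K),
        IsGradedStructureIso (Ideal.span {L}) ψ →
        IsCSstar (Ideal.map ψ (Ideal.map (Ideal.Quotient.mk (Ideal.span {L}))
          (I ⊔ Ideal.span {L})))) ∧
      IsCSstar (I ⊓ Ideal.span {L})) ∧
    (IsCS I → IsCS (I.colon (Ideal.span {L}))) := by
  obtain ⟨i, hL⟩ := hL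
  exact ⟨fun hI => ⟨isCSstar_colon hI hL0 hL,
    fun n₂ ψ hψ => isCSstar_map_quotient hI hL0 hL ψ hψ, isCSstar_inf hI hL0 hL⟩,
    fun hI => isCS_colon hI hL0 hL⟩

end
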